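/- arXiv:1112.5378 — 12 statements merged into one kernel-verified Lean document; each statement's English description precedes it below -/
import Mathlib

section
/- For integers r ≥ 1, 1 ≤ i ≤ r, and n ≥ i, the map sending (S_1,…,S_r) to (S_1+i, …, S_{i−1}+i, {0} ∪ (S_i+i), S_{i+1}+i, …, S_r+i) is a well-defined bijection from P_r(n−i) onto P_r^i(n). -/
/-- `SP r n S`: the `r`-tuple `S` (with `S i` playing the role of `S_{i+1}`) of subsets of
`{0, …, n-1}` is an order-`r` shadowed partition of `n`: the shifted sets `S_i + j`,
`1 ≤ i ≤ r`, `0 ≤ j ≤ i - 1`, are pairwise disjoint with union `{0, …, n-1}`. -/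
def SP (r n : ℕ) (S : Fin r → Finset ℕ) : Prop :=
  (∀ p q : Σ i : Fin r, Fin ((i : ℕ) + 1), p ≠ q →
      Disjoint ((S p.1).image (· + (p.2 : ℕ))) ((S q.1).image (· + (q.2 : ℕ)))) ∧
    (Finset.univ : Finset (Σ i : Fin r, Fin ((i : ℕ) + 1))).biUnion
        (fun p => (S p.1).image (· + (p.2 : ℕ))) = Finset.range n

/-- Elementwise form of `SP`: every `x < n` is uniquely of the form `a + j` with `a ∈ S k`
and `j ≤ k`, and no other numbers are of this form. -/
theorem SP_iff (r n : ℕ) (S : Fin r → Finset ℕ) :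
    SP r n S ↔
      (∀ k l : Fin r, ∀ a ∈ S k, ∀ b ∈ S l, ∀ u ≤ (k : ℕ), ∀ v ≤ (l : ℕ),
        a + u = b + v → k = l ∧ u = v) ∧
      ∀ x, (∃ k : Fin r, ∃ a ∈ S k, ∃ u ≤ (k : ℕ), a + u = x) ↔ x < n := by
  unfold SP
  refine and_congr ⟨fun h k l a ha b hb u hu v hv hab => ?_, fun h p q hpq => ?_⟩ ?_
  · by_contra hne
    refine Finset.disjoint_left.1
      (h ⟨k, u, Nat.lt_succ_of_le hu⟩ ⟨l, v, Nat.lt_succ_of_le hv⟩ ?_)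
      (Finset.mem_image_of_mem _ ha) (Finset.mem_image.2 ⟨b, hb, hab.symm⟩)
    intro heq
    obtain ⟨rfl, h2⟩ := Sigma.mk.inj_iff.1 heq
    exact hne ⟨rfl, congrArg Fin.val (eq_of_heq h2)⟩
  · obtain ⟨k, u, hu⟩ := p
    obtain ⟨l, v, hv⟩ := q
    refine Finset.disjoint_left.2 fun x hx hx' => hpq ?_
    obtain ⟨a, ha, rfl⟩ := Finset.mem_image.1 hx
    obtain ⟨b, hb, hab⟩ := Finset.mem_image.1 hx'
    obtain ⟨rfl, rfl⟩ := h k l a ha b hb u (Nat.le_of_lt_succ hu) v (Nat.le_of_lt_succ hv)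
      hab.symm
    rfl
  · rw [Finset.ext_iff]
    refine forall_congr' fun x => ?_
    rw [Finset.mem_range]
    refine iff_congr ?_ Iff.rfl
    simp only [Finset.mem_biUnion, Finset.mem_univ, true_and, Finset.mem_image]
    constructor
    · rintro ⟨⟨k, u, hu⟩, a, ha, rfl⟩
      exact ⟨k, a, ha, u, Nat.le_of_lt_succ hu, rfl⟩
    · rintro ⟨k, a, ha, u, hu, rfl⟩
      exact ⟨⟨k, u, Nat.lt_succ_of_le hu⟩, a, ha, rfl⟩

/-- If `T` is `S` shifted by `i + 1` with `0` added to its `i`-th component, then `T` is a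
shadowed partition of `n` exactly when `S` is one of `n - (i + 1)`. -/
theorem SP_iff_of_shift {r n : ℕ} {i : Fin r} (hin : (i : ℕ) + 1 ≤ n)
    {S T : Fin r → Finset ℕ}
    (hT : ∀ k x, x ∈ T k ↔ (k = i ∧ x = 0) ∨ ∃ a ∈ S k, a + ((i : ℕ) + 1) = x) :
    SP r n T ↔ SP r (n - ((i : ℕ) + 1)) S := by
  have hmem : ∀ k, ∀ a ∈ S k, a + ((i : ℕ) + 1) ∈ T k := fun k a ha =>
    (hT k _).2 (Or.inr ⟨a, ha, rfl⟩)
  have hzero : 0 ∈ T i := (hT i 0).2 (Or.inl ⟨rfl, rfl⟩)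
  rw [SP_iff, SP_iff]
  constructor
  · rintro ⟨hd, hc⟩
    refine ⟨fun k l a ha b hb u hu v hv hab => ?_, fun x => ⟨?_, fun hx => ?_⟩⟩
    · exact hd k l _ (hmem k a ha) _ (hmem l b hb) u hu v hv (by omega)
    · rintro ⟨k, a, ha, u, hu, rfl⟩
      have := (hc _).1 ⟨k, _, hmem k a ha, u, hu, rfl⟩
      omega
    · obtain ⟨k, y, hy, u, hu, hyx⟩ := (hc (x + ((i : ℕ) + 1))).2 (by omega)
      rcases (hT k y).1 hy with ⟨rfl, rfl⟩ | ⟨a, ha, rfl⟩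
      · omega
      · exact ⟨k, a, ha, u, hu, by omega⟩
  · rintro ⟨hd, hc⟩
    refine ⟨fun k l y hy z hz u hu v hv hyz => ?_, fun x => ⟨?_, fun hx => ?_⟩⟩
    · rcases (hT k y).1 hy with ⟨rfl, rfl⟩ | ⟨a, ha, rfl⟩ <;>
        rcases (hT l z).1 hz with ⟨rfl, rfl⟩ | ⟨b, hb, rfl⟩
      · exact ⟨rfl, by omega⟩
      · omega
      · omega
      · exact hd k l a ha b hb u hu v hv (by omega)
    · rintro ⟨k, y, hy, u, hu, rfl⟩
      rcases (hT k y).1 hy with ⟨rfl, rfl⟩ | ⟨a, ha, rfl⟩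
      · omega
      · have := (hc _).1 ⟨k, a, ha, u, hu, rfl⟩
        omega
    · by_cases hxi : x ≤ i
      · exact ⟨i, 0, hzero, x, hxi, Nat.zero_add x⟩
      · obtain ⟨k, a, ha, u, hu, hax⟩ := (hc (x - ((i : ℕ) + 1))).2 (by omega)
        exact ⟨k, _, hmem k a ha, u, hu, by omega⟩

/-- In a shadowed partition with `0 ∈ T i`, every element of a component other than that `0`
is at least `i + 1`. -/
theorem SP.eq_zero_or_lt {r n : ℕ} {T : Fin r → Finset ℕ} (h : SP r n T) {i : Fin r}
    (hi : 0 ∈ T i) {k : Fin r} {x : ℕ} (hx : x ∈ T k) : (k = i ∧ x = 0) ∨ (i : ℕ) < x := by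
  by_cases hxi : x ≤ i
  · obtain ⟨hk, h0⟩ := ((SP_iff r n T).1 h).1 k i x hx 0 hi 0 (Nat.zero_le _) x hxi (by omega)
    exact Or.inl ⟨hk, h0.symm⟩
  · exact Or.inr (by omega)

/-- For `1 ≤ i ≤ r` and `n ≥ i` (here `i : Fin r` encodes the index `i+1 ∈ {1, …, r}`),
the map `(S_1, …, S_r) ↦ (S_1 + i, …, {0} ∪ (S_i + i), …, S_r + i)` is a well-defined
bijection from `P_r(n - i)` onto `P_r^i(n) = {S ∈ P_r(n) : 0 ∈ S_i}`. -/
theorem shadowed_partition_shift_bijOn (r n : ℕ) (hr : 1 ≤ r) (i : Fin r)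
    (hin : (i : ℕ) + 1 ≤ n) :
    Set.BijOn
      (fun S : Fin r → Finset ℕ => fun k : Fin r =>
        if k = i then insert 0 ((S k).image (· + ((i : ℕ) + 1)))
        else (S k).image (· + ((i : ℕ) + 1)))
      {S | SP r (n - ((i : ℕ) + 1)) S}
      {S | SP r n S ∧ 0 ∈ S i} := by
  have hmem : ∀ (S : Fin r → Finset ℕ) (k : Fin r) (x : ℕ),
      x ∈ (if k = i then insert 0 ((S k).image (· + ((i : ℕ) + 1)))
        else (S k).image (· + ((i : ℕ) + 1))) ↔
      (k = i ∧ x = 0) ∨ ∃ a ∈ S k, a + ((i : ℕ) + 1) = x := by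
    intro S k x
    split_ifs with hk <;> simp [hk]
  refine ⟨fun S hS => ⟨(SP_iff_of_shift hin (hmem S)).2 hS,
    (hmem S i 0).2 (Or.inl ⟨rfl, rfl⟩)⟩, fun S _ S' _ heq => ?_, ?_⟩
  · have hsub : ∀ k a, a ∈ S k ↔ a ∈ S' k := by
      intro k a
      have h := Finset.ext_iff.1 (congrFun heq k) (a + ((i : ℕ) + 1))
      simpa [hmem] using h
    exact funext fun k => Finset.ext (hsub k)
  · rintro T ⟨hT, h0⟩
    have hpre : ∀ k x, x ∈ T k ↔ (k = i ∧ x = 0) ∨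
        ∃ a ∈ ((T k).filter ((i : ℕ) < ·)).image (· - ((i : ℕ) + 1)),
          a + ((i : ℕ) + 1) = x := by
      intro k x
      simp only [Finset.mem_image, Finset.mem_filter]
      constructor
      · intro hx
        refine (hT.eq_zero_or_lt h0 hx).imp_right fun hlt => ?_
        exact ⟨_, ⟨x, ⟨hx, hlt⟩, rfl⟩, by omega⟩
      · rintro (⟨rfl, rfl⟩ | ⟨_, ⟨y, ⟨hy, hlt⟩, rfl⟩, rfl⟩)
        · exact h0
        · rwa [Nat.sub_add_cancel hlt]
    refine ⟨fun k => ((T k).filter ((i : ℕ) < ·)).image (· - ((i : ℕ) + 1)),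
      (SP_iff_of_shift hin hpre).1 hT, funext fun k => Finset.ext fun x => ?_⟩
    exact (hmem (fun k => ((T k).filter ((i : ℕ) < ·)).image (· - ((i : ℕ) + 1))) k x).trans
      (hpre k x).symm
end

section
/- For every integer r ≥ 1 and every n ≥ 0, the cardinality of P_r(n) equals the r-step Fibonacci number F_n^{(r)}. -/
/-- The `r`-step Fibonacci numbers: `F 0 = 1` and
`F (n+1) = F n + F (n-1) + ⋯ + F (n-r+1)` (terms with negative index being `0`). -/
def rFib (r : ℕ) : ℕ → ℕ
  | 0 => 1
  | n + 1 => ∑ k ∈ Finset.range r, if k ≤ n then rFib r (n - k) else 0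
termination_by n => n
decreasing_by omega

/-- `S` viewed as a tiling of `{0, …, n-1}`: an element `s ∈ S i` is the tile `[s, s + i]`;
tiles stay inside `{0, …, n-1}`, cover it, and two tiles that meet are equal. -/
structure IsTiling (r n : ℕ) (S : Fin r → Finset ℕ) : Prop where
  bound : ∀ i s, s ∈ S i → s + (i : ℕ) < n
  cover : ∀ x < n, ∃ i s, s ∈ S i ∧ s ≤ x ∧ x ≤ s + (i : ℕ)
  eq_of_meet : ∀ i s j t, s ∈ S i → t ∈ S j → s ≤ t + (j : ℕ) → t ≤ s + (i : ℕ) → i = j ∧ s = t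

theorem sp_iff_isTiling (r n : ℕ) (S : Fin r → Finset ℕ) : SP r n S ↔ IsTiling r n S := by
  constructor
  · rintro ⟨hdisj, hunion⟩
    have hmem (x : ℕ) : (∃ p : Σ i : Fin r, Fin ((i : ℕ) + 1), ∃ s ∈ S p.1, s + (p.2 : ℕ) = x) ↔
        x < n := by
      simpa using Finset.ext_iff.mp hunion x
    refine ⟨fun i s hs => ?_, fun x hx => ?_, fun i s j t hs ht hst hts => ?_⟩
    · exact (hmem _).mp ⟨⟨i, Fin.last _⟩, s, hs, rfl⟩
    · obtain ⟨⟨i, k⟩, s, hs, rfl⟩ := (hmem x).mpr hx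
      exact ⟨i, s, hs, by simp, by have := k.isLt; simp only; omega⟩
    · by_contra hne
      let p : Σ i : Fin r, Fin ((i : ℕ) + 1) := ⟨i, ⟨max s t - s, by omega⟩⟩
      let q : Σ i : Fin r, Fin ((i : ℕ) + 1) := ⟨j, ⟨max s t - t, by omega⟩⟩
      have hpq : p ≠ q := by
        intro h
        have hij : i = j := congrArg Sigma.fst h
        have hk : max s t - s = max s t - t :=
          congrArg (fun a : Σ i : Fin r, Fin ((i : ℕ) + 1) => (a.2 : ℕ)) h
        exact hne ⟨hij, by omega⟩
      refine Finset.disjoint_left.mp (hdisj p q hpq) (?_ : max s t ∈ _) ?_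
      · exact Finset.mem_image.mpr ⟨s, hs, by simp only [p]; omega⟩
      · exact Finset.mem_image.mpr ⟨t, ht, by simp only [q]; omega⟩
  · rintro ⟨hbound, hcover, hmeet⟩
    refine ⟨?_, ?_⟩
    · rintro ⟨i, k⟩ ⟨j, l⟩ hne
      refine Finset.disjoint_left.mpr fun x hx hy => hne ?_
      obtain ⟨s, hs, hsx⟩ := Finset.mem_image.mp hx
      obtain ⟨t, ht, htx⟩ := Finset.mem_image.mp hy
      have hk := k.isLt
      have hl := l.isLt
      simp only at hs ht hsx htx hk hl
      obtain ⟨rfl, rfl⟩ := hmeet i s j t hs ht (by omega) (by omega)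
      obtain rfl : k = l := Fin.ext (by omega)
      rfl
    · ext x
      simp only [Finset.mem_biUnion, Finset.mem_univ, true_and, Finset.mem_image, Finset.mem_range]
      constructor
      · rintro ⟨⟨i, k⟩, s, hs, rfl⟩
        have := hbound i s hs
        have := k.isLt
        simp only
        omega
      · intro hx
        obtain ⟨i, s, hs, hsx, hxs⟩ := hcover x hx
        exact ⟨⟨i, ⟨x - s, by omega⟩⟩, s, hs, by simp only; omega⟩

/-- Add the tile `[s, s + i]` to `S`. -/
def addTile {r : ℕ} (i : Fin r) (s : ℕ) (S : Fin r → Finset ℕ) : Fin r → Finset ℕ :=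
  Function.update S i (insert s (S i))

theorem mem_addTile {r : ℕ} {i j : Fin r} {s t : ℕ} {S : Fin r → Finset ℕ} :
    t ∈ addTile i s S j ↔ (j = i ∧ t = s) ∨ t ∈ S j := by
  rcases eq_or_ne j i with rfl | h <;> simp [addTile, *]

namespace IsTiling

variable {r n : ℕ} {S : Fin r → Finset ℕ}

theorem notMem (h : IsTiling r n S) (i : Fin r) : n ∉ S i := fun hn => by
  have := h.bound i n hn
  omega

theorem addTile (h : IsTiling r n S) (i : Fin r) :
    IsTiling r (n + i + 1) (addTile i n S) := by
  refine ⟨fun j s hs => ?_, fun x hx => ?_, fun j s k t hs ht hst hts => ?_⟩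
  · rcases mem_addTile.mp hs with ⟨rfl, rfl⟩ | hs
    · omega
    · have := h.bound j s hs
      omega
  · rcases lt_or_ge x n with hxn | hxn
    · obtain ⟨j, s, hs, hx'⟩ := h.cover x hxn
      exact ⟨j, s, mem_addTile.mpr (Or.inr hs), hx'⟩
    · exact ⟨i, n, mem_addTile.mpr (Or.inl ⟨rfl, rfl⟩), hxn, by omega⟩
  · rw [mem_addTile] at hs ht
    rcases hs with ⟨rfl, rfl⟩ | hs <;> rcases ht with ⟨rfl, rfl⟩ | ht
    · exact ⟨rfl, rfl⟩
    · have := h.bound k t ht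
      omega
    · have := h.bound j s hs
      omega
    · exact h.eq_of_meet j s k t hs ht hst hts

/-- Every tiling of a nonempty interval arises by adding a last tile. -/
theorem exists_addTile (h : IsTiling r (n + 1) S) :
    ∃ i : Fin r, (i : ℕ) ≤ n ∧ ∃ T, IsTiling r (n - i) T ∧ _root_.addTile i (n - i) T = S := by
  obtain ⟨i, s, hs, hsn, hns⟩ := h.cover n n.lt_succ_self
  have hb := h.bound i s hs
  obtain rfl : s = n - i := by omega
  have hmem (j : Fin r) (t : ℕ) : t ∈ Function.update S i ((S i).erase (n - i)) j ↔
      ¬(j = i ∧ t = n - i) ∧ t ∈ S j := by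
    rcases eq_or_ne j i with rfl | hj <;> simp [*]
  have hlt (j : Fin r) (t : ℕ) (hne : ¬(j = i ∧ t = n - i)) (ht : t ∈ S j) :
      t + (j : ℕ) < n - i := by
    by_contra hge
    have := h.bound j t ht
    exact hne (h.eq_of_meet j t i (n - i) ht hs (by omega) (by omega))
  refine ⟨i, by omega, Function.update S i ((S i).erase (n - i)),
    ⟨fun j t ht => ?_, fun x hx => ?_, fun j t k u ht hu => ?_⟩, ?_⟩
  · rw [hmem] at ht
    exact hlt j t ht.1 ht.2
  · obtain ⟨j, t, ht, htx, hxt⟩ := h.cover x (by omega)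
    exact ⟨j, t, (hmem j t).mpr ⟨fun hjt => by omega, ht⟩, htx, hxt⟩
  · exact h.eq_of_meet j t k u ((hmem j t).mp ht).2 ((hmem k u).mp hu).2
  · ext j t
    rw [mem_addTile, hmem]
    by_cases hjt : j = i ∧ t = n - i
    · obtain ⟨rfl, rfl⟩ := hjt
      simpa using hs
    · simp [hjt]

theorem addTile_injOn (i : Fin r) : Set.InjOn (_root_.addTile i n) {S | IsTiling r n S} := by
  intro S hS T hT hST
  ext j t
  have hmem : t ∈ _root_.addTile i n S j ↔ t ∈ _root_.addTile i n T j := by rw [hST]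
  rw [mem_addTile, mem_addTile] at hmem
  by_cases hjt : j = i ∧ t = n
  · obtain ⟨rfl, rfl⟩ := hjt
    exact iff_of_false (hS.notMem j) (hT.notMem j)
  · simpa [hjt] using hmem

end IsTiling

theorem isTiling_zero_iff {r : ℕ} {S : Fin r → Finset ℕ} : IsTiling r 0 S ↔ S = fun _ => ∅ := by
  constructor
  · intro h
    funext i
    exact Finset.eq_empty_of_forall_notMem fun s hs => absurd (h.bound i s hs) (Nat.not_lt_zero _)
  · rintro rfl
    constructor <;> simp

/-- The tilings of an interval of length `n` form a finite set with `rFib r n` elements. -/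
theorem exists_finset_isTiling (r n : ℕ) :
    ∃ P : Finset (Fin r → Finset ℕ), (∀ S, S ∈ P ↔ IsTiling r n S) ∧ P.card = rFib r n := by
  classical
  induction n using Nat.strong_induction_on with
  | _ n ih =>
  rcases n with _ | n
  · exact ⟨{fun _ => ∅}, fun S => by rw [Finset.mem_singleton, isTiling_zero_iff], by simp [rFib]⟩
  have ih' (k : ℕ) : ∃ P : Finset (Fin r → Finset ℕ),
      (∀ S, S ∈ P ↔ IsTiling r (n - k) S) ∧ P.card = rFib r (n - k) := ih _ (by omega)
  choose P hP hcard using ih'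
  let Q (i : Fin r) : Finset (Fin r → Finset ℕ) :=
    if (i : ℕ) ≤ n then (P i).image (addTile i (n - i)) else ∅
  have hQ (i : Fin r) (S : Fin r → Finset ℕ) : S ∈ Q i ↔
      (i : ℕ) ≤ n ∧ ∃ T, IsTiling r (n - i) T ∧ addTile i (n - i) T = S := by
    by_cases hi : (i : ℕ) ≤ n <;> simp [Q, hi, hP]
  have hQtiling {i : Fin r} {S : Fin r → Finset ℕ} (hS : S ∈ Q i) :
      IsTiling r (n + 1) S ∧ n - i ∈ S i ∧ (i : ℕ) ≤ n := by
    obtain ⟨hi, T, hT, rfl⟩ := (hQ i S).mp hS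
    have h := hT.addTile i
    rw [Nat.sub_add_cancel hi] at h
    exact ⟨h, mem_addTile.mpr (Or.inl ⟨rfl, rfl⟩), hi⟩
  refine ⟨Finset.univ.biUnion Q, fun S => ?_, ?_⟩
  · rw [Finset.mem_biUnion]
    constructor
    · rintro ⟨i, -, hS⟩
      exact (hQtiling hS).1
    · intro h
      obtain ⟨i, hi⟩ := h.exists_addTile
      exact ⟨i, Finset.mem_univ i, (hQ i S).mpr hi⟩
  · rw [Finset.card_biUnion, rFib, Finset.sum_range]
    · refine Finset.sum_congr rfl fun i _ => ?_
      by_cases hi : (i : ℕ) ≤ n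
      · simp only [Q, hi, if_true]
        rw [Finset.card_image_of_injOn, hcard]
        exact (IsTiling.addTile_injOn i).mono fun S hS => (hP i S).mp hS
      · simp [Q, hi]
    · intro i _ j _ hij
      refine Finset.disjoint_left.mpr fun S hSi hSj => hij ?_
      obtain ⟨h, hi, hin⟩ := hQtiling hSi
      obtain ⟨-, hj, hjn⟩ := hQtiling hSj
      exact (h.eq_of_meet i _ j _ hi hj (by omega) (by omega)).1

/-- For every `r ≥ 1` and every `n ≥ 0`, the number of order-`r` shadowed partitions of `n`
equals the `r`-step Fibonacci number `F_n^{(r)}`. -/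
theorem shadowed_partition_card (r n : ℕ) (hr : 1 ≤ r) :
    Set.ncard {S : Fin r → Finset ℕ | SP r n S} = rFib r n := by
  obtain ⟨P, hP, hcard⟩ := exists_finset_isTiling r n
  rw [← hcard, ← Set.ncard_coe_finset]
  congr 1
  ext S
  exact (sp_iff_isTiling r n S).trans (hP S).symm
end

section
/- For integers r ≥ 1 and n ≥ 0, the map sending a shadowed partition S = (S_1,…,S_r) ∈ P_r(n) to the union ∪S := S_1 ∪ … ∪ S_r is injective from P_r(n) into the set of subsets of {0,1,…,n−1}; consequently |P_r(n)| ≤ 2^n. -/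
namespace SP

variable {r n : ℕ} {S T : Fin r → Finset ℕ}

/-- Each point lies in at most one shifted set. -/
theorem eq_of_add_eq (h : SP r n S) {i k : Fin r} {j l s t : ℕ} (hj : j ≤ i) (hl : l ≤ k)
    (hs : s ∈ S i) (ht : t ∈ S k) (hst : s + j = t + l) : i = k ∧ j = l := by
  by_contra hne
  refine Finset.disjoint_left.mp
    (h.1 ⟨i, ⟨j, Nat.lt_succ_of_le hj⟩⟩ ⟨k, ⟨l, Nat.lt_succ_of_le hl⟩⟩ ?_)
    (Finset.mem_image_of_mem (· + j) hs) ?_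
  · intro heq
    have hik : i = k := congrArg Sigma.fst heq
    subst hik
    exact hne ⟨rfl, by simpa using heq⟩
  · exact Finset.mem_image.mpr ⟨t, ht, hst.symm⟩

theorem add_lt (h : SP r n S) {i : Fin r} {j s : ℕ} (hj : j ≤ i) (hs : s ∈ S i) :
    s + j < n := by
  rw [← Finset.mem_range, ← h.2]
  exact Finset.mem_biUnion.mpr ⟨⟨i, ⟨j, Nat.lt_succ_of_le hj⟩⟩, Finset.mem_univ _,
    Finset.mem_image_of_mem (· + j) hs⟩

theorem exists_add_eq (h : SP r n S) {x : ℕ} (hx : x < n) :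
    ∃ (i : Fin r) (j s : ℕ), j ≤ i ∧ s ∈ S i ∧ s + j = x := by
  rw [← Finset.mem_range, ← h.2] at hx
  obtain ⟨⟨i, j⟩, -, hp⟩ := Finset.mem_biUnion.mp hx
  obtain ⟨s, hs, hsx⟩ := Finset.mem_image.mp hp
  exact ⟨i, j, s, Nat.le_of_lt_succ j.2, hs, hsx⟩

/-- If every starting point of `S` is one of `T`, an interval of `T` is no longer than the
interval of `S` starting at the same point. -/
theorem index_le (hS : SP r n S) (hT : SP r n T)
    (hST : Finset.univ.biUnion S ⊆ Finset.univ.biUnion T) {i k : Fin r} {x : ℕ}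
    (hxS : x ∈ S i) (hxT : x ∈ T k) : k ≤ i := by
  by_contra! hik
  have hik' : (i : ℕ) + 1 ≤ k := hik
  obtain ⟨m, j, s, hj, hs, hsx⟩ := hS.exists_add_eq (hT.add_lt hik' hxT)
  rcases j with _ | j
  · obtain ⟨l, -, hl⟩ := Finset.mem_biUnion.mp
      (hST (Finset.mem_biUnion.mpr ⟨m, Finset.mem_univ m, hs⟩))
    have := (hT.eq_of_add_eq (Nat.zero_le _) hik' hl hxT hsx).2
    omega
  · obtain ⟨rfl, rfl⟩ := hS.eq_of_add_eq (by omega : j ≤ m) le_rfl hs hxS (by omega)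
    omega

theorem subset_of_biUnion_eq (hS : SP r n S) (hT : SP r n T)
    (hST : Finset.univ.biUnion S = Finset.univ.biUnion T) (i : Fin r) : S i ⊆ T i := by
  intro x hx
  obtain ⟨k, -, hk⟩ := Finset.mem_biUnion.mp
    (hST.subset (Finset.mem_biUnion.mpr ⟨i, Finset.mem_univ i, hx⟩))
  rwa [le_antisymm (hT.index_le hS hST.symm.subset hk hx) (hS.index_le hT hST.subset hx hk)]

end SP

/-- The map `S = (S_1, …, S_r) ↦ ∪S := S_1 ∪ ⋯ ∪ S_r` maps `P_r(n)` into the subsets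
of `{0, …, n-1}` and is injective on `P_r(n)`; consequently `|P_r(n)| ≤ 2^n`. -/
theorem shadowed_partition_union_injOn (r n : ℕ) (hr : 1 ≤ r) :
    Set.MapsTo (fun S : Fin r → Finset ℕ => Finset.univ.biUnion S)
      {S | SP r n S} {A : Finset ℕ | A ⊆ Finset.range n} ∧
    Set.InjOn (fun S : Fin r → Finset ℕ => Finset.univ.biUnion S) {S | SP r n S} ∧
    Set.ncard {S : Fin r → Finset ℕ | SP r n S} ≤ 2 ^ n := by
  have hmaps : Set.MapsTo (fun S : Fin r → Finset ℕ => Finset.univ.biUnion S)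
      {S | SP r n S} {A : Finset ℕ | A ⊆ Finset.range n} := by
    intro S hS x hx
    obtain ⟨i, -, hi⟩ := Finset.mem_biUnion.mp hx
    exact Finset.mem_range.mpr (SP.add_lt hS (Nat.zero_le i) hi)
  have hinj : Set.InjOn (fun S : Fin r → Finset ℕ => Finset.univ.biUnion S) {S | SP r n S} :=
    fun S hS T hT hST => funext fun i =>
      (SP.subset_of_biUnion_eq hS hT hST i).antisymm (SP.subset_of_biUnion_eq hT hS hST.symm i)
  have hpow : {A : Finset ℕ | A ⊆ Finset.range n} = ((Finset.range n).powerset : Set _) := by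
    ext A
    simp only [Set.mem_ofPred_eq, Finset.mem_coe, Finset.mem_powerset]
  refine ⟨hmaps, hinj, ?_⟩
  calc Set.ncard {S : Fin r → Finset ℕ | SP r n S}
      ≤ Set.ncard ((Finset.range n).powerset : Set (Finset ℕ)) :=
        Set.ncard_le_ncard_of_injOn _ (hpow ▸ hmaps) hinj (Finset.finite_toSet _)
    _ = 2 ^ n := by rw [Set.ncard_coe_finset, Finset.card_powerset, Finset.card_range]
end

section
/- Let q ≥ 2 be an integer. For every integer r ≥ 1, every n ≥ 1, and every shadowed partition (S_1,…,S_r) ∈ P_r(n), one has ∑_{i=1}^r (q^i − 1) w(S_i) = q^n − 1, where w(S) := ∑_{i∈S} q^i. -/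
/-- The weights of all the shifted sets of a shadowed partition add up to `1 + q + ⋯ + q ^ (n-1)`. -/
theorem SP.sum_weight_eq_geom_sum {r n : ℕ} {S : Fin r → Finset ℕ} (hS : SP r n S) (q : ℕ) :
    ∑ i : Fin r, (∑ k ∈ Finset.range ((i : ℕ) + 1), q ^ k) * ∑ j ∈ S i, q ^ j =
      ∑ k ∈ Finset.range n, q ^ k := by
  rw [← hS.2, Finset.sum_biUnion fun p _ p' _ h => hS.1 p p' h, Fintype.sum_sigma]
  refine Finset.sum_congr rfl fun i _ => ?_
  rw [← Fin.sum_univ_eq_sum_range, Finset.sum_mul]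
  refine Finset.sum_congr rfl fun k _ => ?_
  rw [Finset.sum_image fun _ _ _ _ h => Nat.add_right_cancel h, Finset.mul_sum]
  exact Finset.sum_congr rfl fun j _ => by rw [pow_add, mul_comm]

/-- For an integer `q ≥ 2`, every `r ≥ 1`, `n ≥ 1`, and every shadowed partition
`(S_1, …, S_r) ∈ P_r(n)`, one has `∑_{i=1}^r (q^i - 1) w(S_i) = q^n - 1`,
where `w(S) = ∑_{i ∈ S} q^i`. -/
theorem shadowed_partition_weight_sum (q r n : ℕ) (hq : 2 ≤ q) (hr : 1 ≤ r) (hn : 1 ≤ n)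
    (S : Fin r → Finset ℕ) (hS : SP r n S) :
    ∑ i : Fin r, (q ^ ((i : ℕ) + 1) - 1) * ∑ j ∈ S i, q ^ j = q ^ n - 1 := by
  have hq' : 1 ≤ q := by omega
  rw [← geom_sum_mul_of_one_le hq' n, ← hS.sum_weight_eq_geom_sum q, Finset.sum_mul]
  refine Finset.sum_congr rfl fun i _ => ?_
  rw [← geom_sum_mul_of_one_le hq', mul_right_comm]
end

section
/- Let q be a power of a prime p, let L be a field extension of 𝔽_q(T) equipped with an additive valuation v with v(T) = −1, let r ≥ 1 and A_1,…,A_r ∈ L with A_r ≠ 0, and let α_n := ∑_{S ∈ P_r(n)} A^S / D_n(∪S) be the exponential coefficients of φ_T = T + A_1τ + … + A_rτ^r. Set v_0 := min_{1≤i≤r} v(A_i). Then for every z ∈ L and every n ≥ 0, v(α_n z^{q^n}) ≥ q^n ( n/r + min(v_0, 0)/(q−1) + v(z) ); consequently, for every z ∈ L, v(α_n z^{q^n}) → +∞ as n → ∞, i.e. the series ∑_{n≥0} α_n z^{q^n} converges on all of L whenever L is complete with respect to v. -/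
/-- `P_r(n)` as a finite set: all order-`r` shadowed partitions of `n`. -/
noncomputable def SPart (r n : ℕ) : Finset (Fin r → Finset ℕ) :=
  @Finset.filter _ (fun S => SP r n S) (Classical.decPred _)
    (Fintype.piFinset fun _ : Fin r => (Finset.range n).powerset)

/-- The coefficients `α_n = ∑_{S ∈ P_r(n)} A^S / D_n(∪S)` of the exponential series of the
rank-`r` Drinfeld module `φ_T = T + A_1 τ + ⋯ + A_r τ^r` (here `A i = A_{i+1}`). -/
noncomputable def expCoeff (q : ℕ) {L : Type*} [Field L] (T : L) {r : ℕ}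
    (A : Fin r → L) (n : ℕ) : L :=
  ∑ S ∈ SPart r n,
    (∏ i : Fin r, A i ^ ∑ j ∈ S i, q ^ j) /
      ∏ i ∈ Finset.univ.biUnion S, (T ^ q ^ (n - i) - T) ^ q ^ i

open Finset

namespace SP

variable {r n : ℕ} {S : Fin r → Finset ℕ}

theorem pairwise_disjoint (h : SP r n S) {i j : Fin r} (hij : i ≠ j) :
    Disjoint (S i) (S j) := by
  simpa using h.1 ⟨i, 0⟩ ⟨j, 0⟩ (fun e => hij (congrArg Sigma.fst e))

theorem biUnion_subset_range (h : SP r n S) : univ.biUnion S ⊆ range n := by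
  intro x hx
  obtain ⟨i, -, hi⟩ := mem_biUnion.1 hx
  rw [← h.2]
  exact mem_biUnion.2 ⟨⟨i, 0⟩, mem_univ _, by simpa using hi⟩

theorem card_biUnion (h : SP r n S) : (univ.biUnion S).card = ∑ i, (S i).card :=
  Finset.card_biUnion fun _ _ _ _ hij => h.pairwise_disjoint hij

theorem sum_mul_card (h : SP r n S) : ∑ i : Fin r, ((i : ℕ) + 1) * (S i).card = n := by
  have hc := congrArg Finset.card h.2
  rw [Finset.card_biUnion fun p _ q _ hpq => h.1 p q hpq, card_range] at hc
  simp only [card_image_of_injective _ (add_left_injective _)] at hc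
  rw [← hc, Fintype.sum_sigma]
  simp

theorem le_mul_card_biUnion (h : SP r n S) : n ≤ r * (univ.biUnion S).card := by
  rw [h.card_biUnion, mul_sum]
  calc n = ∑ i : Fin r, ((i : ℕ) + 1) * (S i).card := h.sum_mul_card.symm
    _ ≤ ∑ i : Fin r, r * (S i).card :=
      sum_le_sum fun i _ => Nat.mul_le_mul_right _ i.isLt

theorem sum_weight_le (h : SP r n S) (q : ℕ) :
    ∑ i : Fin r, ∑ j ∈ S i, q ^ j ≤ ∑ j ∈ range n, q ^ j := by
  rw [← sum_biUnion fun i _ j _ hij => h.pairwise_disjoint hij]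
  exact sum_le_sum_of_subset h.biUnion_subset_range

end SP

section Valuation

variable {L : Type*} [Field L] {v : L → EReal}

theorem valuation_one (hv0 : ∀ x : L, v x = ⊤ ↔ x = 0) (hvb : ∀ x : L, v x ≠ ⊥)
    (hvm : ∀ x y : L, v (x * y) = v x + v y) : v 1 = 0 := by
  have h := hvm 1 1
  rw [mul_one] at h
  lift v 1 to ℝ using ⟨mt (hv0 1).1 one_ne_zero, hvb 1⟩ with a
  norm_cast at h ⊢
  linarith

theorem le_valuation_mul (hvm : ∀ x y : L, v (x * y) = v x + v y) {a b : ℝ} {x y : L}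
    (hx : (a : EReal) ≤ v x) (hy : (b : EReal) ≤ v y) : ((a + b : ℝ) : EReal) ≤ v (x * y) := by
  rw [hvm, EReal.coe_add]
  exact add_le_add hx hy

theorem le_valuation_prod (h1 : v 1 = 0) (hvm : ∀ x y : L, v (x * y) = v x + v y)
    {ι : Type*} (s : Finset ι) (a : ι → ℝ) (x : ι → L) (h : ∀ i ∈ s, (a i : EReal) ≤ v (x i)) :
    ((∑ i ∈ s, a i : ℝ) : EReal) ≤ v (∏ i ∈ s, x i) := by
  classical
  induction s using Finset.induction_on with
  | empty => simp [h1]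
  | insert i s hi ih =>
    rw [sum_insert hi, prod_insert hi]
    exact le_valuation_mul hvm (h i (mem_insert_self i s))
      (ih fun j hj => h j (mem_insert_of_mem hj))

theorem le_valuation_pow (h1 : v 1 = 0) (hvm : ∀ x y : L, v (x * y) = v x + v y)
    {a : ℝ} {x : L} (h : (a : EReal) ≤ v x) (k : ℕ) : ((k * a : ℝ) : EReal) ≤ v (x ^ k) := by
  simpa using le_valuation_prod h1 hvm (range k) (fun _ => a) (fun _ => x) fun _ _ => h

theorem le_valuation_sum (hv0 : ∀ x : L, v x = ⊤ ↔ x = 0)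
    (hva : ∀ x y : L, min (v x) (v y) ≤ v (x + y)) {ι : Type*} (s : Finset ι) {a : EReal}
    (x : ι → L) (h : ∀ i ∈ s, a ≤ v (x i)) : a ≤ v (∑ i ∈ s, x i) := by
  classical
  induction s using Finset.induction_on with
  | empty => simp [(hv0 0).2 rfl]
  | insert i s hi ih =>
    rw [sum_insert hi]
    exact (le_min (h i (mem_insert_self i s)) (ih fun j hj => h j (mem_insert_of_mem hj))).trans
      (hva _ _)

theorem valuation_pow_of_eq (h1 : v 1 = 0) (hvm : ∀ x y : L, v (x * y) = v x + v y)
    {a : ℝ} {x : L} (h : v x = a) (k : ℕ) : v (x ^ k) = ((k * a : ℝ) : EReal) := by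
  induction k with
  | zero => simp [h1]
  | succ k ih =>
    rw [pow_succ, hvm, ih, h, ← EReal.coe_add, Nat.cast_succ, add_one_mul]

/-- The inverse of `T ^ Q - T` has valuation at least `Q` when `v T = -1` and `Q > 1`. -/
theorem le_valuation_inv_pow_sub (hv0 : ∀ x : L, v x = ⊤ ↔ x = 0) (hvb : ∀ x : L, v x ≠ ⊥)
    (hvm : ∀ x y : L, v (x * y) = v x + v y) (hva : ∀ x y : L, min (v x) (v y) ≤ v (x + y))
    {T : L} (hvT : v T = -1) {Q : ℕ} (hQ : 1 < Q) :
    (((Q : ℝ)) : EReal) ≤ v (T ^ Q - T)⁻¹ := by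
  have h1 := valuation_one hv0 hvb hvm
  have hT : v T = ((-1 : ℝ) : EReal) := by rw [hvT]; norm_num
  have hQ' : (1 : ℝ) < Q := by exact_mod_cast hQ
  have hle : v (T ^ Q - T) ≤ ((-Q : ℝ) : EReal) := by
    have h := hva (T ^ Q - T) T
    rw [sub_add_cancel, valuation_pow_of_eq h1 hvm hT, mul_neg_one, hT] at h
    refine (min_le_iff.1 h).resolve_right fun h' => ?_
    rw [EReal.coe_le_coe_iff] at h'
    linarith
  have hne : T ^ Q - T ≠ 0 := fun h0 => by
    rw [(hv0 _).2 h0] at hle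
    exact EReal.coe_ne_top _ (top_le_iff.1 hle)
  have hmul := hvm (T ^ Q - T) (T ^ Q - T)⁻¹
  rw [mul_inv_cancel₀ hne, h1] at hmul
  lift v (T ^ Q - T) to ℝ using ⟨mt (hv0 _).1 hne, hvb _⟩ with a
  lift v (T ^ Q - T)⁻¹ to ℝ using ⟨mt (hv0 _).1 (inv_ne_zero hne), hvb _⟩ with b
  norm_cast at hle hmul ⊢
  push_cast at hle
  linarith

/-- The contribution of a single shadowed partition to the exponential coefficient. -/
theorem le_valuation_term (hv0 : ∀ x : L, v x = ⊤ ↔ x = 0) (hvb : ∀ x : L, v x ≠ ⊥)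
    (hvm : ∀ x y : L, v (x * y) = v x + v y) (hva : ∀ x y : L, min (v x) (v y) ≤ v (x + y))
    {T : L} (hvT : v T = -1) {q : ℕ} (hq : 1 < q) {r : ℕ} (hr : 1 ≤ r) {A : Fin r → L} {c : ℝ}
    (hc : c ≤ 0) (hA : ∀ i, (c : EReal) ≤ v (A i)) {n : ℕ} {S : Fin r → Finset ℕ}
    (hS : SP r n S) :
    (((q : ℝ) ^ n * (n / r + c * ((q : ℝ) - 1)⁻¹) : ℝ) : EReal) ≤
      v ((∏ i : Fin r, A i ^ ∑ j ∈ S i, q ^ j) /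
        ∏ i ∈ univ.biUnion S, (T ^ q ^ (n - i) - T) ^ q ^ i) := by
  have h1 := valuation_one hv0 hvb hvm
  have hq' : (1 : ℝ) < q := by exact_mod_cast hq
  have hnum := le_valuation_prod h1 hvm univ _ _
    fun i _ => le_valuation_pow h1 hvm (hA i) (∑ j ∈ S i, q ^ j)
  have hden : (((univ.biUnion S).card * (q : ℝ) ^ n : ℝ) : EReal) ≤
      v (∏ i ∈ univ.biUnion S, (T ^ q ^ (n - i) - T) ^ q ^ i)⁻¹ := by
    have h := le_valuation_prod h1 hvm (univ.biUnion S) (fun _ => (q : ℝ) ^ n)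
      (fun i => ((T ^ q ^ (n - i) - T)⁻¹) ^ q ^ i) fun i hi => by
        have hin : i < n := mem_range.1 (hS.biUnion_subset_range hi)
        have h := le_valuation_pow h1 hvm (le_valuation_inv_pow_sub hv0 hvb hvm hva hvT
          (Nat.one_lt_pow (by omega : n - i ≠ 0) hq)) (q ^ i)
        rwa [← Nat.cast_mul, ← pow_add, Nat.add_sub_cancel' hin.le, Nat.cast_pow] at h
    simpa [prod_inv_distrib] using h
  have hquot := le_valuation_mul hvm hnum hden
  rw [← div_eq_mul_inv] at hquot
  refine le_trans (EReal.coe_le_coe_iff.2 ?_) hquot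
  rw [← sum_mul, ← Nat.cast_sum]
  have hr' : (0 : ℝ) < r := by exact_mod_cast hr
  have hcard : (n : ℝ) / r ≤ (univ.biUnion S).card := by
    rw [div_le_iff₀' hr']
    exact_mod_cast hS.le_mul_card_biUnion
  have hw : ((∑ i : Fin r, ∑ j ∈ S i, q ^ j : ℕ) : ℝ) ≤ (q : ℝ) ^ n * ((q : ℝ) - 1)⁻¹ := by
    have h : ((∑ i : Fin r, ∑ j ∈ S i, q ^ j : ℕ) : ℝ) ≤ ∑ j ∈ range n, (q : ℝ) ^ j := by
      exact_mod_cast hS.sum_weight_le q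
    refine h.trans ?_
    rw [geom_sum_eq hq'.ne', div_eq_mul_inv]
    exact mul_le_mul_of_nonneg_right (by linarith) (inv_nonneg.2 (by linarith))
  have hcw := mul_le_mul_of_nonpos_right hw hc
  have hcq := mul_le_mul_of_nonneg_right hcard (by positivity : (0 : ℝ) ≤ (q : ℝ) ^ n)
  linarith

theorem le_valuation_expCoeff (hv0 : ∀ x : L, v x = ⊤ ↔ x = 0) (hvb : ∀ x : L, v x ≠ ⊥)
    (hvm : ∀ x y : L, v (x * y) = v x + v y) (hva : ∀ x y : L, min (v x) (v y) ≤ v (x + y))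
    {T : L} (hvT : v T = -1) {q : ℕ} (hq : 1 < q) {r : ℕ} (hr : 1 ≤ r) {A : Fin r → L} {c : ℝ}
    (hc : c ≤ 0) (hA : ∀ i, (c : EReal) ≤ v (A i)) (n : ℕ) :
    (((q : ℝ) ^ n * (n / r + c * ((q : ℝ) - 1)⁻¹) : ℝ) : EReal) ≤ v (expCoeff q T A n) := by
  classical
  exact le_valuation_sum hv0 hva _ _ fun _ hS =>
    le_valuation_term hv0 hvb hvm hva hvT hq hr hc hA (by
      unfold SPart at hS
      exact (mem_filter.1 hS).2)

end Valuation

/-- Let `q = p^s` be a prime power, `L` a field extension of `𝔽_q(T)` with additive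
valuation `v` (valued in `ℝ ∪ {∞} = ` `EReal`, with `v x = ⊤ ↔ x = 0`) satisfying
`v T = -1`, and let `φ_T = T + A_1 τ + ⋯ + A_r τ^r` with `A_r ≠ 0` have exponential
coefficients `α_n`.  With `v₀ := min_i v(A_i)`, for every `z` and `n`:
`v(α_n z^{q^n}) ≥ q^n (n/r + min(v₀,0)/(q-1) + v z)`; consequently
`v(α_n z^{q^n}) → ∞`, i.e. the series `∑ α_n z^{q^n}` converges on all of `L`
whenever `L` is complete. -/
theorem expCoeff_valuation_bound (p q s : ℕ) (hp : p.Prime) (hs : 1 ≤ s) (hq : q = p ^ s)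
    (L : Type*) [Field L] [CharP L p]
    (v : L → EReal) (hv0 : ∀ x : L, v x = ⊤ ↔ x = 0) (hvb : ∀ x : L, v x ≠ ⊥)
    (hvm : ∀ x y : L, v (x * y) = v x + v y)
    (hva : ∀ x y : L, min (v x) (v y) ≤ v (x + y))
    (T : L) (hvT : v T = -1)
    (r : ℕ) (hr : 1 ≤ r) (A : Fin r → L) (hAr : A ⟨r - 1, by omega⟩ ≠ 0) :
    (∀ z : L, ∀ n : ℕ,
      (((q : ℝ) ^ n : ℝ) : EReal) *
          ((((n : ℝ) / (r : ℝ) : ℝ) : EReal) +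
            min (Finset.univ.inf fun i : Fin r => v (A i)) 0 * ((((q : ℝ) - 1)⁻¹ : ℝ) : EReal) +
            v z)
        ≤ v (expCoeff q T A n * z ^ q ^ n)) ∧
    ∀ z : L, ∀ M : ℝ, ∃ N : ℕ, ∀ n : ℕ, N ≤ n →
      (M : EReal) < v (expCoeff q T A n * z ^ q ^ n) := by
  have hq1 : 1 < q := hq ▸ Nat.one_lt_pow (by omega) hp.one_lt
  have hq' : (1 : ℝ) < q := by exact_mod_cast hq1
  have hr' : (0 : ℝ) < r := by exact_mod_cast hr
  obtain ⟨c, hcm⟩ : ∃ c : ℝ, (c : EReal) = min (univ.inf fun i : Fin r => v (A i)) 0 := by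
    refine ⟨_, EReal.coe_toReal (ne_top_of_le_ne_top EReal.zero_ne_top (min_le_right _ _))
      (ne_of_gt (lt_min ?_ EReal.bot_lt_zero))⟩
    exact (Finset.lt_inf_iff (by simp)).2 fun i _ => bot_lt_iff_ne_bot.2 (hvb _)
  have hc : c ≤ 0 := by
    have h : (c : EReal) ≤ 0 := hcm.le.trans (min_le_right _ _)
    exact_mod_cast h
  have hA : ∀ i, (c : EReal) ≤ v (A i) := fun i =>
    hcm.le.trans ((min_le_left _ _).trans (inf_le (mem_univ i)))
  have hzero : ∀ n, v (expCoeff q T A n * 0 ^ q ^ n) = ⊤ := fun n =>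
    (hv0 _).2 (by rw [zero_pow (pow_ne_zero n (by omega)), mul_zero])
  have key : ∀ (z : L) (b : ℝ), (b : EReal) = v z → ∀ n : ℕ,
      (((q : ℝ) ^ n * (n / r + c * ((q : ℝ) - 1)⁻¹ + b) : ℝ) : EReal) ≤
        v (expCoeff q T A n * z ^ q ^ n) := fun z b hb n => by
    have h := le_valuation_mul hvm (le_valuation_expCoeff hv0 hvb hvm hva hvT hq1 hr hc hA n)
      (le_valuation_pow (valuation_one hv0 hvb hvm) hvm hb.le (q ^ n))
    rwa [Nat.cast_pow, ← mul_add] at h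
  have hreal : ∀ z : L, z ≠ 0 → ∃ b : ℝ, (b : EReal) = v z := fun z hz =>
    ⟨_, EReal.coe_toReal (mt (hv0 z).1 hz) (hvb z)⟩
  refine ⟨fun z n => ?_, fun z M => ?_⟩
  · rcases eq_or_ne z 0 with rfl | hz
    · exact (hzero n).symm ▸ le_top
    · obtain ⟨b, hb⟩ := hreal z hz
      rw [← hcm, ← hb]
      exact_mod_cast key z b hb n
  · rcases eq_or_ne z 0 with rfl | hz
    · exact ⟨0, fun n _ => (hzero n).symm ▸ EReal.coe_lt_top M⟩
    · obtain ⟨b, hb⟩ := hreal z hz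
      obtain ⟨N, hN⟩ := exists_nat_ge ((|M| + 1 - (c * ((q : ℝ) - 1)⁻¹ + b)) * r)
      refine ⟨N, fun n hn => lt_of_lt_of_le (EReal.coe_lt_coe_iff.2 ?_) (key z b hb n)⟩
      have hNn : (N : ℝ) ≤ n := by exact_mod_cast hn
      have hlow : |M| + 1 - (c * ((q : ℝ) - 1)⁻¹ + b) ≤ n / r :=
        (le_div_iff₀ hr').2 (hN.trans hNn)
      have hX : |M| + 1 ≤ n / r + c * ((q : ℝ) - 1)⁻¹ + b := by linarith
      have hpow : (1 : ℝ) ≤ (q : ℝ) ^ n := one_le_pow₀ hq'.le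
      calc M < |M| + 1 := by linarith [le_abs_self M]
        _ ≤ n / r + c * ((q : ℝ) - 1)⁻¹ + b := hX
        _ ≤ _ := le_mul_of_one_le_left (by linarith [abs_nonneg M]) hpow
end

section
/- Let q be a power of a prime p, let L be a field extension of 𝔽_q(T), let r ≥ 1, and let A_1,…,A_r ∈ L with A_0 := T. Define, for n ≥ 0, β_n := ∑_{S ∈ P_r(n)} A^S / L(S), where for S = (S_1,…,S_r), L(S) := ∏_{j=1}^r ∏_{i∈S_j} (−[i+j]). Then β_0 = 1 and for every n ≥ 1 the recursion T β_n = ∑_{i=0}^{r} β_{n−i} A_i^{q^{n−i}} holds (with β_k := 0 for k < 0); equivalently, −[n] β_n = ∑_{i=1}^{r} β_{n−i} A_i^{q^{n−i}}. These β_n are the coefficients of the logarithm series log_φ(z) = ∑ β_n z^{q^n} of the rank-r Drinfeld module φ_T = T + A_1τ + … + A_rτ^r. -/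
/-- The coefficients `β_n = ∑_{S ∈ P_r(n)} A^S / L(S)` of the logarithm series of the
rank-`r` Drinfeld module `φ_T = T + A_1 τ + ⋯ + A_r τ^r` (here `A j = A_{j+1}`), where
`L(S) = ∏_{j=1}^r ∏_{i ∈ S_j} (-[i+j])` with `[m] = T^{q^m} - T`. -/
noncomputable def logCoeffFormula (q : ℕ) {L : Type*} [Field L] (T : L) {r : ℕ}
    (A : Fin r → L) (n : ℕ) : L :=
  ∑ S ∈ SPart r n,
    (∏ i : Fin r, A i ^ ∑ j ∈ S i, q ^ j) /
      ∏ j : Fin r, ∏ i ∈ S j, (-(T ^ q ^ (i + (j : ℕ) + 1) - T))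

/-- Shadowed partitions as tilings of `{0, …, n-1}` by the intervals `[s, s + i]`, `s ∈ S i`. -/
theorem SP_iff_tiling {r n : ℕ} {S : Fin r → Finset ℕ} :
    SP r n S ↔
      (∀ (i i' : Fin r) (s s' x : ℕ), s ∈ S i → s' ∈ S i' → s ≤ x → x ≤ s + i → s' ≤ x →
        x ≤ s' + i' → i = i' ∧ s = s') ∧
      (∀ (i : Fin r) (s : ℕ), s ∈ S i → s + i < n) ∧
      (∀ x < n, ∃ (i : Fin r) (s : ℕ), s ∈ S i ∧ s ≤ x ∧ x ≤ s + i) := by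
  constructor
  · rintro ⟨hdisj, hcover⟩
    refine ⟨?_, ?_, ?_⟩
    · intro i i' s s' x hs hs' h1 h2 h3 h4
      by_contra hne
      have hpq : (⟨i, ⟨x - s, by omega⟩⟩ : Σ i : Fin r, Fin ((i : ℕ) + 1)) ≠
          ⟨i', ⟨x - s', by omega⟩⟩ := by
        intro h
        rw [Sigma.mk.injEq] at h
        obtain ⟨rfl, h⟩ := h
        rw [heq_eq_eq, Fin.mk.injEq] at h
        exact hne ⟨rfl, by omega⟩
      exact Finset.disjoint_left.mp (hdisj _ _ hpq)
        (Finset.mem_image.mpr ⟨s, hs, Nat.add_sub_cancel' h1⟩)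
        (Finset.mem_image.mpr ⟨s', hs', Nat.add_sub_cancel' h3⟩)
    · intro i s hs
      rw [← Finset.mem_range, ← hcover]
      exact Finset.mem_biUnion.mpr ⟨⟨i, Fin.last _⟩, Finset.mem_univ _,
        Finset.mem_image.mpr ⟨s, hs, rfl⟩⟩
    · intro x hx
      rw [← Finset.mem_range, ← hcover] at hx
      obtain ⟨⟨i, j⟩, -, hx⟩ := Finset.mem_biUnion.mp hx
      obtain ⟨s, hs, rfl⟩ := Finset.mem_image.mp hx
      exact ⟨i, s, hs, by simp, by simpa using Nat.lt_succ_iff.mp j.isLt⟩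
  · rintro ⟨hdisj, hbound, hcover⟩
    refine ⟨?_, ?_⟩
    · rintro ⟨i, j⟩ ⟨i', j'⟩ hpq
      rw [Finset.disjoint_left]
      intro x hx hx'
      obtain ⟨s, hs, rfl⟩ := Finset.mem_image.mp hx
      obtain ⟨s', hs', h⟩ := Finset.mem_image.mp hx'
      dsimp only at hs hs' h
      have hj := j.isLt
      have hj' := j'.isLt
      obtain ⟨rfl, rfl⟩ := hdisj i i' s s' (s + j) hs hs' (by omega) (by omega) (by omega)
        (by omega)
      exact hpq (by rw [Fin.ext (show (j : ℕ) = j' by omega)])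
    · ext x
      rw [Finset.mem_range, Finset.mem_biUnion]
      constructor
      · rintro ⟨⟨i, j⟩, -, hx⟩
        obtain ⟨s, hs, rfl⟩ := Finset.mem_image.mp hx
        have hj := j.isLt
        have hb := hbound i s hs
        dsimp only
        omega
      · intro hx
        obtain ⟨i, s, hs, h1, h2⟩ := hcover x hx
        exact ⟨⟨i, ⟨x - s, by omega⟩⟩, Finset.mem_univ _,
          Finset.mem_image.mpr ⟨s, hs, Nat.add_sub_cancel' h1⟩⟩

theorem mem_SPart {r n : ℕ} {S : Fin r → Finset ℕ} : S ∈ SPart r n ↔ SP r n S := by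
  simp only [SPart, Finset.mem_filter]
  rw [and_iff_right_iff_imp, Fintype.mem_piFinset]
  intro h i
  rw [Finset.mem_powerset]
  intro s hs
  have := (SP_iff_tiling.mp h).2.1 i s hs
  exact Finset.mem_range.mpr (by omega)

/-- Exactly one tile of a nonempty shadowed partition ends at the last point. -/
theorem SP.existsUnique_last {r n : ℕ} {S : Fin r → Finset ℕ} (h : SP r n S) (hn : 1 ≤ n) :
    ∃! k : Fin r, (k : ℕ) + 1 ≤ n ∧ n - ((k : ℕ) + 1) ∈ S k := by
  obtain ⟨hdisj, hbound, hcover⟩ := SP_iff_tiling.mp h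
  obtain ⟨k, s, hs, h1, h2⟩ := hcover (n - 1) (by omega)
  have hb := hbound k s hs
  obtain rfl : s = n - ((k : ℕ) + 1) := by omega
  refine ⟨k, ⟨by omega, hs⟩, ?_⟩
  rintro k' ⟨hk', hs'⟩
  exact (hdisj k' k _ _ (n - 1) hs' hs (by omega) (by omega) (by omega) (by omega)).1

theorem mem_update_insert {r m s : ℕ} {S : Fin r → Finset ℕ} {k i : Fin r} :
    s ∈ Function.update S k (insert m (S k)) i ↔ (i = k ∧ s = m) ∨ s ∈ S i := by
  rcases eq_or_ne i k with rfl | hik <;> simp [*]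

theorem mem_update_erase {r m s : ℕ} {S : Fin r → Finset ℕ} {k i : Fin r} :
    s ∈ Function.update S k ((S k).erase m) i ↔ ¬(i = k ∧ s = m) ∧ s ∈ S i := by
  rcases eq_or_ne i k with rfl | hik <;> simp [*]

/-- Appending a tile of length `k + 1`. -/
theorem SP.update_insert {r m : ℕ} {S : Fin r → Finset ℕ} (h : SP r m S) (k : Fin r) :
    SP r (m + (k + 1)) (Function.update S k (insert m (S k))) := by
  obtain ⟨hdisj, hbound, hcover⟩ := SP_iff_tiling.mp h
  rw [SP_iff_tiling]
  simp only [mem_update_insert]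
  refine ⟨?_, ?_, ?_⟩
  · rintro i i' s s' x (⟨rfl, rfl⟩ | hs) (⟨rfl, rfl⟩ | hs') h1 h2 h3 h4
    · exact ⟨rfl, rfl⟩
    · have := hbound _ _ hs'
      omega
    · have := hbound _ _ hs
      omega
    · exact hdisj i i' s s' x hs hs' h1 h2 h3 h4
  · rintro i s (⟨rfl, rfl⟩ | hs)
    · omega
    · have := hbound _ _ hs
      omega
  · intro x hx
    rcases lt_or_ge x m with hxm | hxm
    · obtain ⟨i, s, hs, h12⟩ := hcover x hxm
      exact ⟨i, s, Or.inr hs, h12⟩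
    · exact ⟨k, m, Or.inl ⟨rfl, rfl⟩, hxm, by omega⟩

/-- Removing the last tile. -/
theorem SP.update_erase {r m : ℕ} {S : Fin r → Finset ℕ} {k : Fin r}
    (h : SP r (m + (k + 1)) S) (hm : m ∈ S k) :
    SP r m (Function.update S k ((S k).erase m)) := by
  obtain ⟨hdisj, hbound, hcover⟩ := SP_iff_tiling.mp h
  rw [SP_iff_tiling]
  simp only [mem_update_erase]
  refine ⟨?_, ?_, ?_⟩
  · rintro i i' s s' x ⟨-, hs⟩ ⟨-, hs'⟩ h1 h2 h3 h4
    exact hdisj i i' s s' x hs hs' h1 h2 h3 h4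
  · rintro i s ⟨hne, hs⟩
    have hb := hbound _ _ hs
    by_contra hlt
    rcases le_total m s with hms | hms
    · exact hne (hdisj i k s m s hs hm le_rfl (by omega) hms (by omega))
    · exact hne (hdisj i k s m m hs hm hms (by omega) le_rfl (by omega))
  · intro x hx
    obtain ⟨i, s, hs, h1, h2⟩ := hcover x (by omega)
    exact ⟨i, s, ⟨fun h => by omega, hs⟩, h1, h2⟩

/-- A shadowed partition of `m` has no tile starting at `m`. -/
theorem SP.notMem_self {r m : ℕ} {S : Fin r → Finset ℕ} (h : SP r m S) (k : Fin r) :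
    m ∉ S k := fun hm => by
  have := (SP_iff_tiling.mp h).2.1 k m hm
  omega

theorem SPart_zero (r : ℕ) : SPart r 0 = {fun _ => ∅} := by
  ext S
  rw [mem_SPart, SP_iff_tiling, Finset.mem_singleton]
  constructor
  · rintro ⟨-, hbound, -⟩
    funext i
    exact Finset.eq_empty_of_forall_notMem fun s hs => by simpa using hbound i s hs
  · rintro rfl
    simp

/-- Splitting a sum over shadowed partitions according to the last tile. -/
theorem sum_SPart_eq_sum_last {M : Type*} [AddCommMonoid M] {r n : ℕ} (hn : 1 ≤ n)
    (f : (Fin r → Finset ℕ) → M) :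
    ∑ S ∈ SPart r n, f S =
      ∑ k : Fin r, if (k : ℕ) + 1 ≤ n then
        ∑ S ∈ SPart r (n - (k + 1)), f (Function.update S k (insert (n - (k + 1)) (S k)))
      else 0 := by
  have hsplit : ∀ S ∈ SPart r n, f S = ∑ k : Fin r,
      if (k : ℕ) + 1 ≤ n ∧ n - ((k : ℕ) + 1) ∈ S k then f S else 0 := by
    intro S hS
    obtain ⟨k, hk, huniq⟩ := (mem_SPart.mp hS).existsUnique_last hn
    rw [Finset.sum_eq_single k (fun k' _ hne => if_neg fun h => hne (huniq k' h)) (by simp),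
      if_pos hk]
  rw [Finset.sum_congr rfl hsplit, Finset.sum_comm]
  refine Finset.sum_congr rfl fun k _ => ?_
  split_ifs with hk
  · obtain ⟨m, rfl⟩ := Nat.exists_eq_add_of_le' hk
    simp only [hk, true_and, Nat.add_sub_cancel]
    rw [← Finset.sum_filter]
    refine Finset.sum_bij' (fun S _ => Function.update S k ((S k).erase m))
      (fun S _ => Function.update S k (insert m (S k))) ?_ ?_ ?_ ?_ ?_
    · intro S hS
      rw [Finset.mem_filter, mem_SPart] at hS
      exact mem_SPart.mpr (hS.1.update_erase hS.2)
    · intro S hS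
      rw [Finset.mem_filter, mem_SPart]
      exact ⟨(mem_SPart.mp hS).update_insert k, by simp⟩
    · intro S hS
      rw [Finset.mem_filter] at hS
      simp [Finset.insert_erase hS.2]
    · intro S hS
      simp [Finset.erase_insert ((mem_SPart.mp hS).notMem_self k)]
    · intro S hS
      rw [Finset.mem_filter] at hS
      simp [Finset.insert_erase hS.2]
  · simp [hk]

/-- The logarithm coefficient as a sum of products over the tiles. -/
theorem logCoeffFormula_eq_sum_prod (q : ℕ) {L : Type*} [Field L] (T : L) {r : ℕ}
    (A : Fin r → L) (n : ℕ) :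
    logCoeffFormula q T A n = ∑ S ∈ SPart r n, ∏ i : Fin r, ∏ s ∈ S i,
      A i ^ q ^ s / (-(T ^ q ^ (s + (i : ℕ) + 1) - T)) := by
  simp only [logCoeffFormula, Finset.prod_div_distrib, Finset.prod_pow_eq_pow_sum]

theorem prod_prod_update_insert {M : Type*} [CommMonoid M] {r m : ℕ} {S : Fin r → Finset ℕ}
    {k : Fin r} (hm : m ∉ S k) (h : Fin r → ℕ → M) :
    ∏ i, ∏ s ∈ Function.update S k (insert m (S k)) i, h i s =
      h k m * ∏ i, ∏ s ∈ S i, h i s := by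
  rw [← Finset.mul_prod_erase _ _ (Finset.mem_univ k),
    ← Finset.mul_prod_erase _ (fun i => ∏ s ∈ S i, h i s) (Finset.mem_univ k),
    Function.update_self, Finset.prod_insert hm, mul_assoc]
  congr 2
  refine Finset.prod_congr rfl fun i hi => ?_
  rw [Function.update_of_ne (Finset.ne_of_mem_erase hi)]

theorem neg_bracket_mul_logCoeffFormula {q : ℕ} {L : Type*} [Field L] {T : L} {r n : ℕ}
    (A : Fin r → L) (hn : 1 ≤ n) (hT : T ^ q ^ n ≠ T) :
    -(T ^ q ^ n - T) * logCoeffFormula q T A n =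
      ∑ i : Fin r,
        (if (i : ℕ) + 1 ≤ n then
          logCoeffFormula q T A (n - ((i : ℕ) + 1)) * A i ^ q ^ (n - ((i : ℕ) + 1))
        else 0) := by
  have hne : -(T ^ q ^ n - T) ≠ 0 := neg_ne_zero.mpr (sub_ne_zero.mpr hT)
  rw [logCoeffFormula_eq_sum_prod, sum_SPart_eq_sum_last hn, Finset.mul_sum]
  refine Finset.sum_congr rfl fun k _ => ?_
  split_ifs with hk
  · rw [logCoeffFormula_eq_sum_prod, Finset.mul_sum, Finset.sum_mul]
    refine Finset.sum_congr rfl fun S hS => ?_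
    rw [prod_prod_update_insert ((mem_SPart.mp hS).notMem_self k), add_assoc,
      Nat.sub_add_cancel hk, ← mul_assoc, mul_div_cancel₀ _ hne, mul_comm]
  · exact mul_zero _

/-- Let `q = p^s` be a prime power, `L` a field extension of `𝔽_q(T)` (encoded: `L` of
characteristic `p`, `T ∈ L` with `T^{q^m} ≠ T` for `m ≥ 1`), `r ≥ 1` and
`A_1, …, A_r ∈ L` with `A_0 := T`.  Then `β_0 = 1` and for every `n ≥ 1`,
`T β_n = ∑_{i=0}^r β_{n-i} A_i^{q^{n-i}}`; equivalently
`-[n] β_n = ∑_{i=1}^r β_{n-i} A_i^{q^{n-i}}` (terms with negative index being `0`):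
these are the coefficients of the logarithm `log_φ(z) = ∑ β_n z^{q^n}` of
`φ_T = T + A_1 τ + ⋯ + A_r τ^r`. -/
theorem logCoeffFormula_recursion (p q s : ℕ) (hp : p.Prime) (hs : 1 ≤ s) (hq : q = p ^ s)
    (L : Type*) [Field L] [CharP L p] (T : L) (hT : ∀ m : ℕ, 1 ≤ m → T ^ q ^ m ≠ T)
    (r : ℕ) (hr : 1 ≤ r) (A : Fin r → L) :
    logCoeffFormula q T A 0 = 1 ∧
    (∀ n : ℕ, 1 ≤ n →
      T * logCoeffFormula q T A n =
        logCoeffFormula q T A n * T ^ q ^ n +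
          ∑ i : Fin r,
            (if (i : ℕ) + 1 ≤ n then
              logCoeffFormula q T A (n - ((i : ℕ) + 1)) * A i ^ q ^ (n - ((i : ℕ) + 1))
            else 0)) ∧
    (∀ n : ℕ, 1 ≤ n →
      -(T ^ q ^ n - T) * logCoeffFormula q T A n =
        ∑ i : Fin r,
          (if (i : ℕ) + 1 ≤ n then
            logCoeffFormula q T A (n - ((i : ℕ) + 1)) * A i ^ q ^ (n - ((i : ℕ) + 1))
          else 0)) := by
  have hrec (n : ℕ) (hn : 1 ≤ n) := neg_bracket_mul_logCoeffFormula A hn (hT n hn)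
  refine ⟨?_, fun n hn => ?_, hrec⟩
  · simp [logCoeffFormula, SPart_zero]
  · rw [← hrec n hn]
    ring
end

section
/- Let q be a power of a prime p, let L be a field extension of 𝔽_q(T) with additive valuation v satisfying v(T) = −1, let A, B ∈ L with B ≠ 0, let β_n be the logarithm coefficients of φ_T = T + Aτ + Bτ², and set j := A^{q+1}/B. Then: (a) if v(j) < −q, then for every n ≥ 0, v(β_n) = ((q^n − 1)/(q − 1))(v(A) + q); (b) if v(j) > −q and n is even, then v(β_n) = ((q^n − 1)/(q² − 1))(v(B) + q²); (c) if v(j) > −q and n is odd, then v(β_n) = ((q^n − 1)/(q² − 1))(v(B) + q²) + (v(j) + q)/(q + 1). -/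
/-- `v` is an additive valuation on the field `L` with values in `ℝ ∪ {∞}`. -/
structure IsAddVal {L : Type*} [Field L] (v : L → EReal) : Prop where
  eq_top_iff : ∀ x, v x = ⊤ ↔ x = 0
  ne_bot : ∀ x, v x ≠ ⊥
  map_mul : ∀ x y, v (x * y) = v x + v y
  map_add : ∀ x y, min (v x) (v y) ≤ v (x + y)

namespace IsAddVal

variable {L : Type*} [Field L] {v : L → EReal}

theorem exists_real (h : IsAddVal v) {x : L} (hx : x ≠ 0) : ∃ r : ℝ, v x = (r : EReal) :=
  ⟨(v x).toReal, (EReal.coe_toReal (fun e => hx ((h.eq_top_iff x).1 e)) (h.ne_bot x)).symm⟩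

theorem ne_zero (h : IsAddVal v) {x : L} {r : ℝ} (hx : v x = (r : EReal)) : x ≠ 0 := by
  intro e
  rw [(h.eq_top_iff x).2 e] at hx
  exact EReal.top_ne_coe r hx

theorem map_mul_real (h : IsAddVal v) {x y : L} {r t : ℝ} (hx : v x = (r : EReal))
    (hy : v y = (t : EReal)) : v (x * y) = ((r + t : ℝ) : EReal) := by
  rw [h.map_mul, hx, hy, EReal.coe_add]

theorem map_one (h : IsAddVal v) : v 1 = ((0 : ℝ) : EReal) := by
  obtain ⟨r, hr⟩ := h.exists_real (one_ne_zero (α := L))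
  have h1 := h.map_mul_real hr hr
  rw [mul_one, hr, EReal.coe_eq_coe_iff] at h1
  rw [hr, EReal.coe_eq_coe_iff]
  linarith

theorem map_neg (h : IsAddVal v) (x : L) : v (-x) = v x := by
  obtain ⟨r, hr⟩ := h.exists_real (neg_ne_zero.2 (one_ne_zero (α := L)))
  have h1 := h.map_mul_real hr hr
  rw [neg_mul_neg, mul_one, h.map_one, EReal.coe_eq_coe_iff] at h1
  have h2 : r = 0 := by linarith
  rw [← neg_one_mul, h.map_mul, hr, h2, EReal.coe_zero, zero_add]

theorem map_pow_real (h : IsAddVal v) {x : L} {r : ℝ} (hx : v x = (r : EReal)) (n : ℕ) :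
    v (x ^ n) = ((n * r : ℝ) : EReal) := by
  induction n with
  | zero => simpa using h.map_one
  | succ n ih =>
    rw [pow_succ, h.map_mul_real ih hx, EReal.coe_eq_coe_iff]
    push_cast
    ring

theorem map_div_real (h : IsAddVal v) {x y : L} {r t : ℝ} (hx : v x = (r : EReal))
    (hy : v y = (t : EReal)) : v (x / y) = ((r - t : ℝ) : EReal) := by
  have hx0 := h.ne_zero hx
  have hy0 := h.ne_zero hy
  obtain ⟨u, hu⟩ := h.exists_real (div_ne_zero hx0 hy0)
  have h1 := h.map_mul_real hu hy
  rw [div_mul_cancel₀ _ hy0, hx, EReal.coe_eq_coe_iff] at h1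
  rw [hu, EReal.coe_eq_coe_iff]
  linarith

theorem map_add_of_lt (h : IsAddVal v) {x y : L} (hxy : v x < v y) : v (x + y) = v x := by
  apply le_antisymm
  · by_contra! hlt
    have h1 := h.map_add (x + y) (-y)
    rw [add_neg_cancel_right, h.map_neg] at h1
    exact (lt_min hlt hxy).not_ge h1
  · simpa [min_eq_left hxy.le] using h.map_add x y

theorem map_neg_bracket (h : IsAddVal v) {T : L} (hT : v T = -1) {N : ℕ} (hN : 1 < N) :
    v (-(T ^ N - T)) = ((-N : ℝ) : EReal) := by
  have hT' : v T = ((-1 : ℝ) : EReal) := by simpa using hT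
  have hN' : (1 : ℝ) < N := by exact_mod_cast hN
  rw [h.map_neg, sub_eq_add_neg, h.map_add_of_lt, h.map_pow_real hT', mul_neg_one]
  rw [h.map_neg, h.map_pow_real hT', hT', EReal.coe_lt_coe_iff]
  linarith

/-- If `(T - T ^ N) x = y` and `v T = -1`, then `v x = v y + N`. -/
theorem of_neg_bracket_mul (h : IsAddVal v) {T x y : L} (hT : v T = -1) {N : ℕ} (hN : 1 < N)
    (hxy : -(T ^ N - T) * x = y) {r : ℝ} (hy : v y = (r : EReal)) :
    v x = ((r + N : ℝ) : EReal) := by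
  have hx0 : x ≠ 0 := by
    rintro rfl
    exact h.ne_zero hy (by rw [← hxy, mul_zero])
  obtain ⟨u, hu⟩ := h.exists_real hx0
  have h1 := h.map_mul_real (h.map_neg_bracket hT hN) hu
  rw [hxy, hy, EReal.coe_eq_coe_iff] at h1
  rw [hu, EReal.coe_eq_coe_iff]
  linarith

end IsAddVal

section Recursion

variable {L : Type*} [Field L] {v : L → EReal} {q : ℕ} {T A B : L} {β : ℕ → L}

/-- Valuations of the logarithm coefficients when `v j < -q`. -/
theorem logCoeff_valuation_of_lt (h : IsAddVal v) (hq : 1 < q) (hT : v T = -1)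
    (hβ0 : β 0 = 1) (hβ1 : -(T ^ q ^ 1 - T) * β 1 = A * β 0)
    (hβ : ∀ n : ℕ,
      -(T ^ q ^ (n + 2) - T) * β (n + 2) = A ^ q ^ (n + 1) * β (n + 1) + B ^ q ^ n * β n)
    {a b : ℝ} (hA : v A = (a : EReal)) (hB : v B = (b : EReal))
    (hj : (q + 1) * a - b < -q) (n : ℕ) :
    v (β n) = ((((q : ℝ) ^ n - 1) / (q - 1) * (a + q) : ℝ) : EReal) := by
  have hq' : (1 : ℝ) < q := by exact_mod_cast hq
  have hq1 : (q : ℝ) - 1 ≠ 0 := by linarith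
  induction n using Nat.twoStepInduction with
  | zero => simpa [hβ0] using h.map_one
  | one =>
    rw [h.of_neg_bracket_mul hT (Nat.one_lt_pow one_ne_zero hq) hβ1
      (h.map_mul_real hA (hβ0 ▸ h.map_one)), EReal.coe_eq_coe_iff]
    push_cast
    field_simp
    ring
  | more n ih0 ih1 =>
    have hx := h.map_mul_real (h.map_pow_real hA (q ^ (n + 1))) ih1
    have hy := h.map_mul_real (h.map_pow_real hB (q ^ n)) ih0
    have hqn : (0 : ℝ) < (q : ℝ) ^ n := by positivity
    have hlt : v (A ^ q ^ (n + 1) * β (n + 1)) < v (B ^ q ^ n * β n) := by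
      rw [hx, hy, EReal.coe_lt_coe_iff, ← sub_pos]
      have : 0 < (q : ℝ) ^ n * (b - (q + 1) * a - q) := mul_pos hqn (by linarith)
      convert this using 1
      push_cast
      field_simp
      ring
    rw [h.of_neg_bracket_mul hT (Nat.one_lt_pow (by omega) hq) (hβ n)
      ((h.map_add_of_lt hlt).trans hx), EReal.coe_eq_coe_iff]
    push_cast
    field_simp
    ring

/-- The valuation of `β (n + 2)` when the `B`-term of the recursion dominates. -/
theorem logCoeff_valuation_add_two (h : IsAddVal v) (hq : 1 < q) (hT : v T = -1) {n : ℕ}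
    (hβ : -(T ^ q ^ (n + 2) - T) * β (n + 2) = A ^ q ^ (n + 1) * β (n + 1) + B ^ q ^ n * β n)
    {b y : ℝ} (hB : v B = (b : EReal))
    (hn : v (β n) = ((((q : ℝ) ^ n - 1) / (q ^ 2 - 1) * (b + q ^ 2) + y : ℝ) : EReal))
    (hlt : v (B ^ q ^ n * β n) < v (A ^ q ^ (n + 1) * β (n + 1))) :
    v (β (n + 2)) =
      ((((q : ℝ) ^ (n + 2) - 1) / (q ^ 2 - 1) * (b + q ^ 2) + y : ℝ) : EReal) := by
  have hq' : (1 : ℝ) < q := by exact_mod_cast hq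
  have hq2 : (q : ℝ) ^ 2 - 1 ≠ 0 := by nlinarith
  rw [add_comm (A ^ _ * _)] at hβ
  rw [h.of_neg_bracket_mul hT (Nat.one_lt_pow (by omega) hq) hβ
    ((h.map_add_of_lt hlt).trans (h.map_mul_real (h.map_pow_real hB _) hn)),
    EReal.coe_eq_coe_iff]
  push_cast
  field_simp
  ring

/-- Valuations of the logarithm coefficients when `-q < v j` and `A ≠ 0`. -/
theorem logCoeff_valuation_of_gt (h : IsAddVal v) (hq : 1 < q) (hT : v T = -1)
    (hβ0 : β 0 = 1) (hβ1 : -(T ^ q ^ 1 - T) * β 1 = A * β 0)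
    (hβ : ∀ n : ℕ,
      -(T ^ q ^ (n + 2) - T) * β (n + 2) = A ^ q ^ (n + 1) * β (n + 1) + B ^ q ^ n * β n)
    {a b : ℝ} (hA : v A = (a : EReal)) (hB : v B = (b : EReal))
    (hj : -q < (q + 1) * a - b) (n : ℕ) :
    v (β n) = ((((q : ℝ) ^ n - 1) / (q ^ 2 - 1) * (b + q ^ 2) +
      if Even n then 0 else ((q + 1) * a - b + q) / (q + 1) : ℝ) : EReal) := by
  have hq' : (1 : ℝ) < q := by exact_mod_cast hq
  have hq2 : (q : ℝ) ^ 2 - 1 ≠ 0 := by nlinarith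
  have hq3 : (q : ℝ) + 1 ≠ 0 := by linarith
  obtain ⟨y, hy⟩ : ∃ y : ℝ, y = ((q + 1) * a - b + q) / (q + 1) := ⟨_, rfl⟩
  have hypos : 0 < y := hy ▸ div_pos (by linarith) (by linarith)
  have hb : b = (q + 1) * a + q - (q + 1) * y := by
    rw [hy]
    field_simp
    ring
  rw [← hy]
  induction n using Nat.twoStepInduction with
  | zero => simpa [hβ0] using h.map_one
  | one =>
    rw [h.of_neg_bracket_mul hT (Nat.one_lt_pow one_ne_zero hq) hβ1
      (h.map_mul_real hA (hβ0 ▸ h.map_one)), EReal.coe_eq_coe_iff, if_neg Nat.not_even_one, hb]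
    push_cast
    field_simp
    ring
  | more n ih0 ih1 =>
    have hx := h.map_mul_real (h.map_pow_real hA (q ^ (n + 1))) ih1
    have hz := h.map_mul_real (h.map_pow_real hB (q ^ n)) ih0
    have heven : Even (n + 2) ↔ Even n := by simp [Nat.even_add]
    simp only [heven]
    refine logCoeff_valuation_add_two h hq hT (hβ n) hB ih0 ?_
    rw [hx, hz, EReal.coe_lt_coe_iff, ← sub_pos]
    have hpow : 1 < (q : ℝ) ^ (n + 1) := one_lt_pow₀ hq' (by omega)
    by_cases hn : Even n
    · rw [if_pos hn, if_neg (by simpa [Nat.even_add_one] using hn)]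
      have : 0 < ((q : ℝ) ^ (n + 1) + 1) * y := mul_pos (by linarith) hypos
      convert this using 1
      rw [hb]
      push_cast
      field_simp
      ring
    · rw [if_neg hn, if_pos (by simpa [Nat.even_add_one] using hn)]
      have : 0 < ((q : ℝ) ^ (n + 1) - 1) * y := mul_pos (by linarith) hypos
      convert this using 1
      rw [hb]
      push_cast
      field_simp
      ring

/-- Valuations of the logarithm coefficients when `A = 0`. -/
theorem logCoeff_valuation_of_eq_zero (h : IsAddVal v) (hq : 1 < q) (hT : v T = -1)
    (hβ0 : β 0 = 1) (hβ1 : -(T ^ q ^ 1 - T) * β 1 = 0)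
    (hβ : ∀ n : ℕ,
      -(T ^ q ^ (n + 2) - T) * β (n + 2) = 0 ^ q ^ (n + 1) * β (n + 1) + B ^ q ^ n * β n)
    {b : ℝ} (hB : v B = (b : EReal)) (n : ℕ) :
    v (β n) = if Even n then
      ((((q : ℝ) ^ n - 1) / (q ^ 2 - 1) * (b + q ^ 2) : ℝ) : EReal) else ⊤ := by
  have hzero (k : ℕ) (hk : k ≠ 0) (x : L) (hx : -(T ^ q ^ k - T) * x = 0) : x = 0 :=
    (mul_eq_zero.1 hx).resolve_left
      (h.ne_zero (h.map_neg_bracket hT (Nat.one_lt_pow hk hq)))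
  induction n using Nat.twoStepInduction with
  | zero => simpa [hβ0] using h.map_one
  | one => simpa [h.eq_top_iff] using hzero 1 one_ne_zero _ hβ1
  | more n ih0 _ =>
    have h0 : (0 : L) ^ q ^ (n + 1) = 0 := zero_pow (by positivity)
    have heven : Even (n + 2) ↔ Even n := by simp [Nat.even_add]
    simp only [heven]
    by_cases hn : Even n
    · rw [if_pos hn] at ih0 ⊢
      have hlt : v (B ^ q ^ n * β n) < v (0 ^ q ^ (n + 1) * β (n + 1)) := by
        rw [h0, zero_mul, (h.eq_top_iff 0).2 rfl,
          h.map_mul_real (h.map_pow_real hB (q ^ n)) ih0]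
        exact EReal.coe_lt_top _
      simpa using logCoeff_valuation_add_two h hq hT (hβ n) (y := 0) hB (by simpa using ih0) hlt
    · rw [if_neg hn, h.eq_top_iff] at ih0 ⊢
      exact hzero (n + 2) (by omega) _ (by rw [hβ, h0, ih0]; ring)

end Recursion

/-- Let `q = p^s` be a prime power, `L` a field extension of `𝔽_q(T)` with additive
valuation `v` (valued in `ℝ ∪ {∞} = ` `EReal`, `v x = ⊤ ↔ x = 0`) satisfying `v T = -1`.
Let `β_n` be the logarithm coefficients of `φ_T = T + A τ + B τ²` (`B ≠ 0`), defined by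
`β_0 = 1` and `-[n] β_n = A^{q^{n-1}} β_{n-1} + B^{q^{n-2}} β_{n-2}`, and let
`j := A^{q+1}/B`.  Then:
(a) if `v j < -q`, then `v(β_n) = ((q^n-1)/(q-1))(v A + q)`;
(b) if `v j > -q` and `n` is even, then `v(β_n) = ((q^n-1)/(q²-1))(v B + q²)`;
(c) if `v j > -q` and `n` is odd, then
    `v(β_n) = ((q^n-1)/(q²-1))(v B + q²) + (v j + q)/(q+1)`. -/
theorem logCoeff_valuation (p q s : ℕ) (hp : p.Prime) (hs : 1 ≤ s) (hq : q = p ^ s)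
    (L : Type*) [Field L] [CharP L p]
    (v : L → EReal) (hv0 : ∀ x : L, v x = ⊤ ↔ x = 0) (hvb : ∀ x : L, v x ≠ ⊥)
    (hvm : ∀ x y : L, v (x * y) = v x + v y)
    (hva : ∀ x y : L, min (v x) (v y) ≤ v (x + y))
    (T : L) (hvT : v T = -1) (A B : L) (hB : B ≠ 0)
    (β : ℕ → L) (hβ0 : β 0 = 1)
    (hβ1 : -(T ^ q ^ 1 - T) * β 1 = A * β 0)
    (hβ : ∀ n : ℕ,
      -(T ^ q ^ (n + 2) - T) * β (n + 2) = A ^ q ^ (n + 1) * β (n + 1) + B ^ q ^ n * β n) :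
    (v (A ^ (q + 1) / B) < ((-(q : ℝ) : ℝ) : EReal) →
      ∀ n : ℕ, v (β n) =
        ((((q : ℝ) ^ n - 1) / ((q : ℝ) - 1) : ℝ) : EReal) * (v A + ((q : ℝ) : EReal))) ∧
    (((-(q : ℝ) : ℝ) : EReal) < v (A ^ (q + 1) / B) →
      ∀ n : ℕ, Even n → v (β n) =
        ((((q : ℝ) ^ n - 1) / ((q : ℝ) ^ 2 - 1) : ℝ) : EReal) *
          (v B + (((q : ℝ) ^ 2 : ℝ) : EReal))) ∧
    (((-(q : ℝ) : ℝ) : EReal) < v (A ^ (q + 1) / B) →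
      ∀ n : ℕ, Odd n → v (β n) =
        ((((q : ℝ) ^ n - 1) / ((q : ℝ) ^ 2 - 1) : ℝ) : EReal) *
            (v B + (((q : ℝ) ^ 2 : ℝ) : EReal)) +
          (v (A ^ (q + 1) / B) + ((q : ℝ) : EReal)) * ((((q : ℝ) + 1)⁻¹ : ℝ) : EReal)) := by
  have h : IsAddVal v := ⟨hv0, hvb, hvm, hva⟩
  have hq1 : 1 < q := hq ▸ Nat.one_lt_pow (by omega) hp.one_lt
  obtain ⟨b, hb⟩ := h.exists_real hB
  rcases eq_or_ne A 0 with rfl | hA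
  · have hj : v (0 ^ (q + 1) / B) = ⊤ := by simp [hv0]
    have key := logCoeff_valuation_of_eq_zero h hq1 hvT hβ0 (by simpa using hβ1) hβ hb
    rw [hj]
    refine ⟨fun hlt => absurd hlt not_top_lt, fun _ n hn => ?_, fun _ n hn => ?_⟩
    · rw [key, if_pos hn, hb]
      norm_cast
    · rw [key, if_neg (Nat.not_even_iff_odd.2 hn), hb, EReal.top_add_coe,
        EReal.top_mul_coe_of_pos (by positivity), ← EReal.coe_add, ← EReal.coe_mul,
        EReal.coe_add_top]
  · obtain ⟨a, ha⟩ := h.exists_real hA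
    have hj := h.map_div_real (h.map_pow_real ha (q + 1)) hb
    rw [Nat.cast_add_one] at hj
    rw [hj, EReal.coe_lt_coe_iff, EReal.coe_lt_coe_iff, ha, hb]
    refine ⟨fun hlt n => ?_, fun hgt n hn => ?_, fun hgt n hn => ?_⟩
    · rw [logCoeff_valuation_of_lt h hq1 hvT hβ0 hβ1 hβ ha hb hlt, EReal.coe_mul,
        EReal.coe_add]
    · rw [logCoeff_valuation_of_gt h hq1 hvT hβ0 hβ1 hβ ha hb hgt, if_pos hn, add_zero,
        EReal.coe_mul, EReal.coe_add]
    · rw [logCoeff_valuation_of_gt h hq1 hvT hβ0 hβ1 hβ ha hb hgt,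
        if_neg (Nat.not_even_iff_odd.2 hn), div_eq_mul_inv _ ((q : ℝ) + 1)]
      simp only [EReal.coe_mul, EReal.coe_add]
end

section
/- Let q be a power of a prime p, let L be a field extension of 𝔽_q(T) with additive valuation v satisfying v(T) = −1, let A, B ∈ L with B ≠ 0, let β_n be the logarithm coefficients of φ_T = T + Aτ + Bτ², and suppose v(j) = −q where j := A^{q+1}/B. Then for every n ≥ 0, v(β_n) ≥ ((q^n − 1)/(q − 1))(v(A) + q) = ((q^n − 1)/(q² − 1))(v(B) + q²), and equality holds for infinitely many n. -/
/-- An additive valuation on a field with values in `ℝ ∪ {∞}`, written inside `EReal`. -/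
structure IsRealAddValuation {L : Type*} [Field L] (v : L → EReal) : Prop where
  eq_top_iff : ∀ x, v x = ⊤ ↔ x = 0
  ne_bot : ∀ x, v x ≠ ⊥
  map_mul : ∀ x y, v (x * y) = v x + v y
  min_le_map_add : ∀ x y, min (v x) (v y) ≤ v (x + y)

namespace IsRealAddValuation

variable {L : Type*} [Field L] {v : L → EReal}

lemma exists_coe (h : IsRealAddValuation v) {x : L} (hx : x ≠ 0) : ∃ r : ℝ, v x = r :=
  ⟨(v x).toReal, (EReal.coe_toReal (mt (h.eq_top_iff x).1 hx) (h.ne_bot x)).symm⟩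

lemma ne_zero_of_eq_coe (h : IsRealAddValuation v) {x : L} {r : ℝ} (hx : v x = r) : x ≠ 0 := by
  rintro rfl
  rw [(h.eq_top_iff 0).2 rfl] at hx
  exact EReal.coe_ne_top r hx.symm

lemma map_one (h : IsRealAddValuation v) : v 1 = 0 := by
  obtain ⟨r, hr⟩ := h.exists_coe (one_ne_zero (α := L))
  have h1 := h.map_mul 1 1
  rw [mul_one, hr] at h1
  norm_cast at h1
  rw [hr]
  norm_cast
  linarith

lemma map_neg (h : IsRealAddValuation v) (x : L) : v (-x) = v x := by
  obtain ⟨r, hr⟩ := h.exists_coe (neg_ne_zero.2 (one_ne_zero (α := L)))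
  have h1 := h.map_mul (-1) (-1)
  rw [neg_mul_neg, mul_one, h.map_one, hr] at h1
  norm_cast at h1
  have h0 : r = 0 := by linarith
  rw [← neg_one_mul, h.map_mul, hr, h0, EReal.coe_zero, zero_add]

lemma map_pow (h : IsRealAddValuation v) {x : L} {r : ℝ} (hx : v x = r) (n : ℕ) :
    v (x ^ n) = ((n * r : ℝ) : EReal) := by
  induction n with
  | zero => simp [h.map_one]
  | succ n ih =>
    rw [pow_succ, h.map_mul, ih, hx]
    norm_cast
    push_cast
    ring

lemma map_add_of_lt (h : IsRealAddValuation v) {x y : L} (hxy : v x < v y) :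
    v (x + y) = v x := by
  apply le_antisymm
  · have h1 := h.min_le_map_add (x + y) (-y)
    rw [add_neg_cancel_right, h.map_neg] at h1
    exact (min_le_iff.1 h1).resolve_right hxy.not_ge
  · simpa [hxy.le] using h.min_le_map_add x y

/-- `v ([n]) = -q^n`, where the exponent `m` stands for `q^n`. -/
lemma map_pow_sub_self (h : IsRealAddValuation v) {T : L} (hT : v T = -1) {m : ℕ} (hm : 1 < m) :
    v (T ^ m - T) = ((-m : ℝ) : EReal) := by
  have hT' : v T = ((-1 : ℝ) : EReal) := by simp [hT]
  have hpow : v (T ^ m) = ((-m : ℝ) : EReal) := by rw [h.map_pow hT']; norm_num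
  rw [sub_eq_add_neg, h.map_add_of_lt, hpow]
  rw [hpow, h.map_neg, hT', EReal.coe_lt_coe_iff]
  have : (1 : ℝ) < m := by exact_mod_cast hm
  linarith

lemma le_map_of_mul_eq (h : IsRealAddValuation v) {t z s : L} {τ c : ℝ} (ht : v t = τ)
    (hz : t * z = s) (hs : ((c + τ : ℝ) : EReal) ≤ v s) : (c : EReal) ≤ v z := by
  rcases eq_or_ne z 0 with rfl | hz0
  · simp [(h.eq_top_iff 0).2 rfl]
  · obtain ⟨r, hr⟩ := h.exists_coe hz0
    rw [← hz, h.map_mul, ht, hr] at hs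
    rw [hr]
    norm_cast at hs ⊢
    linarith

lemma map_eq_of_mul_eq (h : IsRealAddValuation v) {t z s : L} {τ c : ℝ} (ht : v t = τ)
    (hz : t * z = s) (hs : v s = ((c + τ : ℝ) : EReal)) : v z = c := by
  have hz0 : z ≠ 0 := by
    rintro rfl
    exact h.ne_zero_of_eq_coe hs (by rw [← hz, mul_zero])
  obtain ⟨r, hr⟩ := h.exists_coe hz0
  rw [← hz, h.map_mul, ht, hr] at hs
  rw [hr]
  norm_cast at hs ⊢
  linarith

lemma le_map_mul (h : IsRealAddValuation v) {a x : L} {α c : ℝ} (ha : v a = α)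
    (hx : (c : EReal) ≤ v x) : ((c + α : ℝ) : EReal) ≤ v (a * x) := by
  rw [h.map_mul, ha, add_comm c, EReal.coe_add]
  gcongr

lemma lt_map_mul (h : IsRealAddValuation v) {a x : L} {α c : ℝ} (ha : v a = α)
    (hx : (c : EReal) < v x) : ((c + α : ℝ) : EReal) < v (a * x) := by
  rw [h.map_mul, ha, add_comm c, EReal.coe_add]
  exact EReal.add_lt_add_left_coe hx α

section Recursion

variable {β a b t : ℕ → L} {c α γ τ : ℕ → ℝ}

/-- If both terms of a two-step linear recursion are balanced with respect to the weights `c`,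
then the weights bound the valuations of the solution from below. -/
lemma le_map_recursion (h : IsRealAddValuation v)
    (ha : ∀ n, v (a n) = α n) (hb : ∀ n, v (b n) = γ n) (ht : ∀ n, v (t n) = τ n)
    (hβ : ∀ n, t n * β (n + 2) = a n * β (n + 1) + b n * β n)
    (hα : ∀ n, c (n + 1) + α n = c (n + 2) + τ n) (hγ : ∀ n, c n + γ n = c (n + 2) + τ n)
    (h0 : c 0 ≤ v (β 0)) (h1 : c 1 ≤ v (β 1)) (n : ℕ) : c n ≤ v (β n) := by
  induction n using Nat.twoStepInduction with
  | zero => exact h0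
  | one => exact h1
  | more n ih ih' =>
    refine h.le_map_of_mul_eq (ht n) (hβ n) (le_trans (le_min ?_ ?_) (h.min_le_map_add _ _))
    · exact hα n ▸ h.le_map_mul (ha n) ih'
    · exact hγ n ▸ h.le_map_mul (hb n) ih

/-- In a balanced recursion the lower bound is attained at one of any two consecutive indices. -/
lemma map_recursion_eq_or_eq (h : IsRealAddValuation v)
    (ha : ∀ n, v (a n) = α n) (hb : ∀ n, v (b n) = γ n) (ht : ∀ n, v (t n) = τ n)
    (hβ : ∀ n, t n * β (n + 2) = a n * β (n + 1) + b n * β n)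
    (hα : ∀ n, c (n + 1) + α n = c (n + 2) + τ n) (hγ : ∀ n, c n + γ n = c (n + 2) + τ n)
    (h0 : v (β 0) = c 0) (h1 : c 1 ≤ v (β 1)) (n : ℕ) :
    v (β n) = c n ∨ v (β (n + 1)) = c (n + 1) := by
  induction n with
  | zero => exact Or.inl h0
  | succ n ih =>
    refine or_iff_not_imp_left.2 fun hne => ?_
    have hn := ih.resolve_right hne
    have hlt := lt_of_le_of_ne
      (h.le_map_recursion ha hb ht hβ hα hγ h0.ge h1 (n + 1)) (Ne.symm hne)
    have hbn : v (b n * β n) = ((c (n + 2) + τ n : ℝ) : EReal) := by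
      rw [h.map_mul, hb, hn, ← hγ, add_comm (c n), EReal.coe_add]
    have han : v (b n * β n) < v (a n * β (n + 1)) := by
      rw [hbn, ← hα]
      exact h.lt_map_mul (ha n) hlt
    refine h.map_eq_of_mul_eq (ht n) (hβ n) ?_
    rw [add_comm, h.map_add_of_lt han, hbn]

end Recursion

end IsRealAddValuation

/-- Let `q = p^s` be a prime power, `L` a field extension of `𝔽_q(T)` with additive
valuation `v` (valued in `ℝ ∪ {∞} = ` `EReal`, `v x = ⊤ ↔ x = 0`) satisfying `v T = -1`.
Let `β_n` be the logarithm coefficients of `φ_T = T + A τ + B τ²` (`B ≠ 0`), and suppose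
`v j = -q` where `j := A^{q+1}/B`.  Then for every `n`,
`v(β_n) ≥ ((q^n-1)/(q-1))(v A + q) = ((q^n-1)/(q²-1))(v B + q²)`, and equality holds
for infinitely many `n`. -/
theorem logCoeff_valuation_boundary (p q s : ℕ) (hp : p.Prime) (hs : 1 ≤ s) (hq : q = p ^ s)
    (L : Type*) [Field L] [CharP L p]
    (v : L → EReal) (hv0 : ∀ x : L, v x = ⊤ ↔ x = 0) (hvb : ∀ x : L, v x ≠ ⊥)
    (hvm : ∀ x y : L, v (x * y) = v x + v y)
    (hva : ∀ x y : L, min (v x) (v y) ≤ v (x + y))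
    (T : L) (hvT : v T = -1) (A B : L) (hB : B ≠ 0)
    (β : ℕ → L) (hβ0 : β 0 = 1)
    (hβ1 : -(T ^ q ^ 1 - T) * β 1 = A * β 0)
    (hβ : ∀ n : ℕ,
      -(T ^ q ^ (n + 2) - T) * β (n + 2) = A ^ q ^ (n + 1) * β (n + 1) + B ^ q ^ n * β n)
    (hj : v (A ^ (q + 1) / B) = ((-(q : ℝ) : ℝ) : EReal)) :
    (∀ n : ℕ,
      ((((q : ℝ) ^ n - 1) / ((q : ℝ) - 1) : ℝ) : EReal) * (v A + ((q : ℝ) : EReal))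
        ≤ v (β n)) ∧
    (∀ n : ℕ,
      ((((q : ℝ) ^ n - 1) / ((q : ℝ) - 1) : ℝ) : EReal) * (v A + ((q : ℝ) : EReal)) =
        ((((q : ℝ) ^ n - 1) / ((q : ℝ) ^ 2 - 1) : ℝ) : EReal) *
          (v B + (((q : ℝ) ^ 2 : ℝ) : EReal))) ∧
    (∀ N : ℕ, ∃ n : ℕ, N ≤ n ∧
      v (β n) =
        ((((q : ℝ) ^ n - 1) / ((q : ℝ) - 1) : ℝ) : EReal) * (v A + ((q : ℝ) : EReal))) := by
  have h : IsRealAddValuation v := ⟨hv0, hvb, hvm, hva⟩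
  have hq1 : 1 < q := hq ▸ Nat.one_lt_pow (by omega) hp.one_lt
  have hq1' : (1 : ℝ) < q := by exact_mod_cast hq1
  have hqsub : (q : ℝ) - 1 ≠ 0 := by linarith
  have hqsq : (q : ℝ) ^ 2 - 1 ≠ 0 := by nlinarith
  have hA : A ≠ 0 := by
    rintro rfl
    exact h.ne_zero_of_eq_coe hj (by simp)
  obtain ⟨a, ha⟩ := h.exists_coe hA
  obtain ⟨b, hb⟩ := h.exists_coe hB
  have hab : b = (q + 1) * a + q := by
    have h1 := h.map_mul (A ^ (q + 1) / B) B
    rw [div_mul_cancel₀ _ hB, hj, hb, h.map_pow ha] at h1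
    norm_cast at h1
    push_cast at h1
    linarith
  have hbr (m : ℕ) (hm : m ≠ 0) : v (-(T ^ q ^ m - T)) = ((-(q : ℝ) ^ m : ℝ) : EReal) := by
    rw [h.map_neg, h.map_pow_sub_self hvT (Nat.one_lt_pow hm hq1)]
    push_cast
    rfl
  let c : ℕ → ℝ := fun n => ((q : ℝ) ^ n - 1) / ((q : ℝ) - 1) * (a + q)
  have hc (n : ℕ) :
      ((((q : ℝ) ^ n - 1) / ((q : ℝ) - 1) : ℝ) : EReal) * (v A + ((q : ℝ) : EReal)) = c n := by
    rw [ha, ← EReal.coe_add, ← EReal.coe_mul]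
  have hpow {x : L} {r : ℝ} (hx : v x = r) (n : ℕ) :
      v (x ^ q ^ n) = (((q : ℝ) ^ n * r : ℝ) : EReal) := by
    rw [h.map_pow hx]
    push_cast
    rfl
  have hα (n : ℕ) : c (n + 1) + (q : ℝ) ^ (n + 1) * a = c (n + 2) + -(q : ℝ) ^ (n + 2) := by
    simp only [c]
    field_simp
    ring
  have hγ (n : ℕ) : c n + (q : ℝ) ^ n * b = c (n + 2) + -(q : ℝ) ^ (n + 2) := by
    simp only [c, hab]
    field_simp
    ring
  have h0 : v (β 0) = c 0 := by simp [c, hβ0, h.map_one]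
  have h1 : (c 1 : EReal) ≤ v (β 1) := by
    refine h.le_map_of_mul_eq (hbr 1 one_ne_zero) hβ1 (le_of_eq ?_)
    rw [hβ0, mul_one, ha]
    congr 1
    simp only [c]
    field_simp
    ring
  have hAn (n : ℕ) := hpow ha (n + 1)
  have hBn (n : ℕ) := hpow hb n
  have hTn (n : ℕ) := hbr (n + 2) (by omega)
  refine ⟨fun n => ?_, fun n => ?_, fun N => ?_⟩
  · rw [hc]
    exact h.le_map_recursion hAn hBn hTn hβ hα hγ h0.ge h1 n
  · rw [hc, hb, ← EReal.coe_add, ← EReal.coe_mul]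
    congr 1
    simp only [c, hab]
    field_simp
    ring
  · simp only [hc]
    rcases h.map_recursion_eq_or_eq hAn hBn hTn hβ hα hγ h0 h1 N with hN | hN
    · exact ⟨N, le_rfl, hN⟩
    · exact ⟨N + 1, N.le_succ, hN⟩
end

section
/- Let q be a power of a prime p, let L be a field extension of 𝔽_q(T) with additive valuation v satisfying v(T) = −1, let A, B ∈ L with B ≠ 0, and let β_n be the logarithm coefficients of φ_T = T + Aτ + Bτ². Set ρ_A := −(q + v(A))/(q − 1), ρ_B := −(q² + v(B))/(q² − 1), and ρ_φ := max(ρ_A, ρ_B). Then for every nonzero z ∈ L, v(β_n z^{q^n}) → +∞ as n → ∞ (i.e. the series for log_φ(z) converges) if and only if v(z) > ρ_φ. -/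
/-- An additive valuation with values in `ℝ ∪ {∞}` comes from a nonarchimedean absolute value
through `v = -log |·|`. -/
lemma exists_absoluteValue_of_additive {L : Type*} [Field L] (v : L → EReal)
    (hv0 : ∀ x : L, v x = ⊤ ↔ x = 0) (hvb : ∀ x : L, v x ≠ ⊥)
    (hvm : ∀ x y : L, v (x * y) = v x + v y)
    (hva : ∀ x y : L, min (v x) (v y) ≤ v (x + y)) :
    ∃ f : AbsoluteValue L ℝ, IsNonarchimedean f ∧
      ∀ x : L, x ≠ 0 → v x = ((-Real.log (f x) : ℝ) : EReal) := by
  classical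
  have hcoe : ∀ x : L, x ≠ 0 → v x = ((v x).toReal : EReal) := fun x hx =>
    (EReal.coe_toReal (fun h => hx ((hv0 x).1 h)) (hvb x)).symm
  let g : L → ℝ := fun x => if x = 0 then 0 else Real.exp (-(v x).toReal)
  have g_zero : g 0 = 0 := by simp [g]
  have g_ne : ∀ x : L, x ≠ 0 → g x = Real.exp (-(v x).toReal) := fun x hx => by simp [g, hx]
  have g_nonneg : ∀ x : L, 0 ≤ g x := fun x => by
    by_cases hx : x = 0
    · rw [hx, g_zero]
    · rw [g_ne x hx]; positivity
  have g_mul : ∀ x y : L, g (x * y) = g x * g y := fun x y => by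
    by_cases hx : x = 0
    · simp [hx, g_zero]
    by_cases hy : y = 0
    · simp [hy, g_zero]
    rw [g_ne x hx, g_ne y hy, g_ne _ (mul_ne_zero hx hy), hvm, hcoe x hx, hcoe y hy,
      ← EReal.coe_add, EReal.toReal_coe, EReal.toReal_coe, EReal.toReal_coe, ← Real.exp_add]
    congr 1
    ring
  have g_add : ∀ x y : L, g (x + y) ≤ max (g x) (g y) := fun x y => by
    by_cases hx : x = 0
    · simp [hx, g_zero]
    by_cases hy : y = 0
    · simp [hy, g_zero]
    by_cases hxy : x + y = 0
    · rw [hxy, g_zero]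
      exact le_max_of_le_left (g_nonneg x)
    have h := hva x y
    rw [hcoe x hx, hcoe y hy, hcoe _ hxy, min_le_iff, EReal.coe_le_coe_iff,
      EReal.coe_le_coe_iff] at h
    rw [g_ne x hx, g_ne y hy, g_ne _ hxy, le_max_iff, Real.exp_le_exp, Real.exp_le_exp]
    exact h.imp neg_le_neg neg_le_neg
  refine ⟨{ toFun := g, map_mul' := g_mul, nonneg' := g_nonneg,
            eq_zero' := fun x => ⟨fun h => ?_, fun h => h ▸ g_zero⟩,
            add_le' := fun x y => (g_add x y).trans
              (max_le_add_of_nonneg (g_nonneg x) (g_nonneg y)) }, g_add, fun x hx => ?_⟩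
  · by_contra hx
    rw [g_ne x hx] at h
    exact (Real.exp_pos _).ne' h
  · change v x = ((-Real.log (g x) : ℝ) : EReal)
    rw [g_ne x hx, Real.log_exp, neg_neg]
    exact hcoe x hx

/-- A two-step recursive bound with ratios `a, d < 1` forces convergence to zero. -/
lemma tendsto_zero_of_two_step_le {c : ℕ → ℝ} {a d : ℝ} {q : ℕ} (hq : 2 ≤ q)
    (hc : ∀ n, 0 ≤ c n) (ha0 : 0 ≤ a) (hd0 : 0 ≤ d) (ha : a < 1) (hd : d < 1)
    (hle : ∀ n, c (n + 2) ≤ max (a ^ q ^ (n + 1) * c (n + 1)) (d ^ q ^ n * c n)) :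
    Filter.Tendsto c Filter.atTop (nhds 0) := by
  obtain ⟨m, hm, hm1⟩ := exists_between (max_lt (max_lt ha hd) zero_lt_one)
  obtain ⟨⟨ham, hdm⟩, hm0⟩ : (a < m ∧ d < m) ∧ 0 < m := by simpa using hm
  have hq0 : ∀ n, q ^ n ≠ 0 := fun n => pow_ne_zero _ (by omega)
  set r := √m with hr
  have hr0 : 0 < r := Real.sqrt_pos.2 hm0
  have hr1 : r < 1 := by rw [hr, Real.sqrt_lt' one_pos]; simpa using hm1
  have hrm : r ^ 2 = m := Real.sq_sqrt hm0.le
  set K := max (c 0) (c 1 / r) with hK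
  have hK0 : 0 ≤ K := (hc 0).trans (le_max_left _ _)
  have bound : ∀ n, c n ≤ K * r ^ n ∧ c (n + 1) ≤ K * r ^ (n + 1) := by
    intro n
    induction n with
    | zero =>
      refine ⟨by simp [hK], ?_⟩
      rw [zero_add, pow_one, ← div_le_iff₀ hr0]
      exact le_max_right _ _
    | succ n ih =>
      refine ⟨ih.2, (hle n).trans ?_⟩
      have hpow : K * r ^ (n + 1 + 1) = m * (K * r ^ n) := by rw [← hrm]; ring
      rw [hpow]
      have hx : a ^ q ^ (n + 1) ≤ m := (pow_le_of_le_one ha0 ha.le (hq0 _)).trans ham.le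
      have hy : d ^ q ^ n ≤ m := (pow_le_of_le_one hd0 hd.le (hq0 _)).trans hdm.le
      refine max_le (mul_le_mul hx (ih.2.trans ?_) (hc _) hm0.le)
        (mul_le_mul hy ih.1 (hc _) hm0.le)
      exact mul_le_mul_of_nonneg_left (pow_le_pow_of_le_one hr0.le hr1.le n.le_succ) hK0
  refine squeeze_zero hc (fun n => (bound n).1) ?_
  simpa using (tendsto_pow_atTop_nhds_zero_of_lt_one hr0.le hr1).const_mul K

/-- A nonarchimedean two-step recursion whose larger ratio is exactly `1` returns to its initial
value infinitely often. -/
lemma eq_or_succ_eq_of_max_eq_one {c : ℕ → ℝ} {a d : ℝ} {q : ℕ} (hq : 2 ≤ q)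
    (hc : ∀ n, 0 ≤ c n) (hc0 : 0 < c 0) (ha0 : 0 ≤ a) (hd0 : 0 ≤ d) (had : max a d = 1)
    (hc1 : c 1 = a * c 0)
    (hle : ∀ n, c (n + 2) ≤ max (a ^ q ^ (n + 1) * c (n + 1)) (d ^ q ^ n * c n))
    (heq : ∀ n, a ^ q ^ (n + 1) * c (n + 1) ≠ d ^ q ^ n * c n →
      c (n + 2) = max (a ^ q ^ (n + 1) * c (n + 1)) (d ^ q ^ n * c n)) (n : ℕ) :
    c n = c 0 ∨ c (n + 1) = c 0 := by
  have hq0 : ∀ n, q ^ n ≠ 0 := fun n => pow_ne_zero _ (by omega)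
  have ha1 : a ≤ 1 := had ▸ le_max_left a d
  have hd1 : d ≤ 1 := had ▸ le_max_right a d
  rcases hd1.lt_or_eq with hd | hd
  · have ha : a = 1 := (max_eq_iff.1 had).elim (fun h => h.1) (fun h => absurd h.1 hd.ne)
    have key : ∀ n, c n = c 0 ∧ c (n + 1) = c 0 := by
      intro n
      induction n with
      | zero => simp [hc1, ha]
      | succ n ih =>
        have hlt : d ^ q ^ n * c n < a ^ q ^ (n + 1) * c (n + 1) := by
          rw [ih.1, ih.2, ha, one_pow]
          exact mul_lt_mul_of_pos_right (pow_lt_one₀ hd0 hd (hq0 n)) hc0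
        refine ⟨ih.2, ?_⟩
        rw [heq n hlt.ne', max_eq_left hlt.le, ha, ih.2, one_pow, one_mul]
    exact Or.inl (key n).1
  · have key : ∀ n, c n ≤ c 0 ∧ c (n + 1) ≤ c 0 ∧ (c n = c 0 ∨ c (n + 1) = c 0) := by
      intro n
      induction n with
      | zero => exact ⟨le_rfl, by rw [zero_add, hc1]; exact mul_le_of_le_one_left hc0.le ha1,
          Or.inl rfl⟩
      | succ n ih =>
        obtain ⟨h0, h1, h⟩ := ih
        have hx : a ^ q ^ (n + 1) * c (n + 1) ≤ c (n + 1) :=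
          mul_le_of_le_one_left (hc _) (pow_le_one₀ ha0 ha1)
        have hy : d ^ q ^ n * c n = c n := by rw [hd, one_pow, one_mul]
        refine ⟨h1, (hle n).trans (max_le (hx.trans h1) (hy.trans_le h0)), ?_⟩
        rcases h1.eq_or_lt with h1 | h1
        · exact Or.inl h1
        · have hcn : c n = c 0 := h.resolve_right h1.ne
          have hlt : a ^ q ^ (n + 1) * c (n + 1) < d ^ q ^ n * c n := by
            rw [hy, hcn]; exact hx.trans_lt h1
          right
          rw [heq n hlt.ne, max_eq_right hlt.le, hy, hcn]
    exact (key n).2.2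

/-- The inequality `-(k + v A) / (k - 1) < v z` in terms of an absolute value with
`v = -log |·|`. -/
lemma neg_add_mul_inv_lt_iff {L : Type*} [Field L] {v : L → EReal} {f : AbsoluteValue L ℝ}
    (hv0 : v 0 = ⊤) (hf : ∀ x : L, x ≠ 0 → v x = ((-Real.log (f x) : ℝ) : EReal))
    {k : ℕ} (hk : 2 ≤ k) (A : L) {z : L} (hz : z ≠ 0) :
    -(((k : ℝ) : EReal) + v A) * ((((k : ℝ) - 1)⁻¹ : ℝ) : EReal) < v z ↔
      f A * f z ^ (k - 1) / Real.exp 1 ^ k < 1 := by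
  have hk1 : (0 : ℝ) < (k : ℝ) - 1 := by
    have : (2 : ℝ) ≤ k := by exact_mod_cast hk
    linarith
  by_cases hA : A = 0
  · rw [hA, hv0, hf z hz, EReal.coe_add_top, EReal.neg_top,
      EReal.bot_mul_coe_of_pos (inv_pos.2 hk1)]
    exact iff_of_true (EReal.bot_lt_coe _) (by simp)
  · have hfA : 0 < f A := f.pos hA
    have hfz : 0 < f z := f.pos hz
    rw [hf A hA, hf z hz, ← EReal.coe_add, ← EReal.coe_neg, ← EReal.coe_mul,
      EReal.coe_lt_coe_iff, ← div_eq_mul_inv, div_lt_iff₀ hk1, div_lt_one (by positivity),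
      ← Real.log_lt_log_iff (x := f A * f z ^ (k - 1)) (by positivity) (by positivity),
      Real.log_mul hfA.ne' (by positivity), Real.log_pow, Real.log_pow, Real.log_exp,
      Nat.cast_sub (by omega), Nat.cast_one]
    constructor <;> intro h <;> linarith

section Recursion

variable {L : Type*} [Field L] {f : AbsoluteValue L ℝ} {T A B : L} {β : ℕ → L} {q : ℕ}

/-- For `|T| > 1`, the absolute value of `[m] = T^{q^m} - T` is `|T|^{q^m}`. -/
lemma abv_neg_pow_sub_self (hf : IsNonarchimedean f) (hT : 1 < f T) {m : ℕ} (hm : 2 ≤ m) :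
    f (-(T ^ m - T)) = f T ^ m := by
  have hlt : f T < f T ^ m := lt_self_pow₀ hT (by omega)
  have hne : f (T ^ m) ≠ f (-T) := by rw [map_pow, f.map_neg]; exact hlt.ne'
  rw [f.map_neg, sub_eq_add_neg, hf.add_eq_max_of_ne hne, map_pow, f.map_neg, max_eq_left hlt.le]

/-- The weighted absolute values `|β_n| R^{q^n}` of the logarithm coefficients satisfy a
nonarchimedean two-step recursion. -/
lemma abv_logCoeff_recursion (hf : IsNonarchimedean f) (hT : 1 < f T) (hq : 2 ≤ q)
    (hβ : ∀ n : ℕ, -(T ^ q ^ (n + 2) - T) * β (n + 2) =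
      A ^ q ^ (n + 1) * β (n + 1) + B ^ q ^ n * β n)
    {R : ℝ} (hR : 0 ≤ R) (n : ℕ) :
    let x := (f A * R ^ (q - 1) / f T ^ q) ^ q ^ (n + 1) * (f (β (n + 1)) * R ^ q ^ (n + 1))
    let y := (f B * R ^ (q ^ 2 - 1) / f T ^ q ^ 2) ^ q ^ n * (f (β n) * R ^ q ^ n)
    f (β (n + 2)) * R ^ q ^ (n + 2) ≤ max x y ∧
      (x ≠ y → f (β (n + 2)) * R ^ q ^ (n + 2) = max x y) := by
  intro x y
  have hT0 : f T ≠ 0 := by linarith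
  have hk : ∀ k : ℕ, k ≠ 0 → ∀ m : ℕ, R ^ (k * m) = (R ^ (k - 1)) ^ m * R ^ m := by
    intro k hk m
    rw [← mul_pow, ← pow_succ, Nat.sub_add_cancel (Nat.pos_of_ne_zero hk), pow_mul]
  set S := (R / f T) ^ q ^ (n + 2) with hS
  have hS0 : 0 ≤ S := by positivity
  have hx : x = f (A ^ q ^ (n + 1) * β (n + 1)) * S := by
    have e : q ^ (n + 2) = q * q ^ (n + 1) := by ring
    simp only [x, hS, map_mul, map_pow, div_pow, mul_pow]
    rw [e, hk q (by omega), pow_mul (f T)]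
    ring
  have hy : y = f (B ^ q ^ n * β n) * S := by
    have e : q ^ (n + 2) = q ^ 2 * q ^ n := by ring
    simp only [y, hS, map_mul, map_pow, div_pow, mul_pow]
    rw [e, hk (q ^ 2) (by positivity), pow_mul (f T)]
    ring
  have hqn : 2 ≤ q ^ (n + 2) := hq.trans (Nat.le_self_pow (by omega) q)
  have hc : f (β (n + 2)) * R ^ q ^ (n + 2) =
      f (A ^ q ^ (n + 1) * β (n + 1) + B ^ q ^ n * β n) * S := by
    rw [← hβ n, map_mul, abv_neg_pow_sub_self hf hT hqn, hS, div_pow]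
    field_simp
  rw [hc, hx, hy, ← max_mul_of_nonneg _ _ hS0]
  refine ⟨mul_le_mul_of_nonneg_right (hf _ _) hS0, fun hne => ?_⟩
  rw [hf.add_eq_max_of_ne fun h => hne (by rw [h])]

/-- For `R > 0`, `|β_n| R^{q^n} → 0` if and only if both ratios of the recursion are less
than `1`. -/
lemma tendsto_abv_logCoeff_iff (hf : IsNonarchimedean f) (hT : 1 < f T) (hq : 2 ≤ q)
    (hβ0 : β 0 = 1) (hβ1 : -(T ^ q ^ 1 - T) * β 1 = A * β 0)
    (hβ : ∀ n : ℕ, -(T ^ q ^ (n + 2) - T) * β (n + 2) =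
      A ^ q ^ (n + 1) * β (n + 1) + B ^ q ^ n * β n)
    {R : ℝ} (hR : 0 < R) :
    Filter.Tendsto (fun n => f (β n) * R ^ q ^ n) Filter.atTop (nhds 0) ↔
      f A * R ^ (q - 1) / f T ^ q < 1 ∧ f B * R ^ (q ^ 2 - 1) / f T ^ q ^ 2 < 1 := by
  have hT0 : 0 < f T := by linarith
  constructor
  · intro hlim
    by_contra hcon
    let g : ℝ → ℝ := fun r =>
      max (f A * r ^ (q - 1) / f T ^ q) (f B * r ^ (q ^ 2 - 1) / f T ^ q ^ 2)
    have hg : Continuous g := by fun_prop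
    have hq2 : 2 ≤ q ^ 2 := hq.trans (Nat.le_self_pow (by omega) q)
    have hg0 : g 0 = 0 := by
      simp [g, zero_pow (show q - 1 ≠ 0 by omega), zero_pow (show q ^ 2 - 1 ≠ 0 by omega)]
    have hgR : 1 ≤ g R := by
      by_contra h
      exact hcon (max_lt_iff.1 (not_le.1 h))
    obtain ⟨r, ⟨hr0, hrR⟩, hr⟩ := intermediate_value_Icc hR.le hg.continuousOn
      ⟨hg0.le.trans zero_le_one, hgR⟩
    have hrpos : 0 < r := hr0.lt_of_ne' fun h => by simp [h, hg0] at hr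
    have hlim' : Filter.Tendsto (fun n => f (β n) * r ^ q ^ n) Filter.atTop (nhds 0) :=
      squeeze_zero (fun n => by positivity)
        (fun n => mul_le_mul_of_nonneg_left (pow_le_pow_left₀ hr0 hrR _) (f.nonneg _)) hlim
    have hinit : f (β 0) * r ^ q ^ 0 = r := by simp [hβ0]
    have hone : f (β 1) * r ^ q ^ 1 =
        f A * r ^ (q - 1) / f T ^ q * (f (β 0) * r ^ q ^ 0) := by
      have h := congrArg f hβ1
      rw [map_mul, map_mul, abv_neg_pow_sub_self hf hT (by simpa using hq), hβ0, map_one,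
        mul_one, pow_one] at h
      rw [hinit, ← h, pow_one, mul_assoc, div_mul_eq_mul_div, eq_div_iff (by positivity)]
      have : r ^ q = r ^ (q - 1) * r := by rw [← pow_succ, Nat.sub_add_cancel (by omega)]
      rw [this]
      ring
    have hrec := abv_logCoeff_recursion hf hT hq hβ hr0
    have hret := eq_or_succ_eq_of_max_eq_one (c := fun n => f (β n) * r ^ q ^ n) hq
      (fun n => by positivity) (by rw [hinit]; exact hrpos) (by positivity) (by positivity) hr
      hone (fun n => (hrec n).1) (fun n => (hrec n).2)
    obtain ⟨N, hN⟩ := Filter.eventually_atTop.1 (hlim'.eventually_lt_const hrpos)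
    simp only [hinit] at hret
    rcases hret N with h | h
    · exact (hN N le_rfl).ne h
    · exact (hN (N + 1) N.le_succ).ne h
  · rintro ⟨ha, hd⟩
    exact tendsto_zero_of_two_step_le hq (fun n => by positivity) (by positivity)
      (by positivity) ha hd (fun n => (abv_logCoeff_recursion hf hT hq hβ hR.le n).1)

end Recursion

/-- Let `q = p^s` be a prime power, `L` a field extension of `𝔽_q(T)` with additive
valuation `v` (valued in `ℝ ∪ {∞} = ` `EReal`, `v x = ⊤ ↔ x = 0`) satisfying `v T = -1`,
and let `β_n` be the logarithm coefficients of `φ_T = T + A τ + B τ²` (`B ≠ 0`).  With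
`ρ_A := -(q + v A)/(q-1)`, `ρ_B := -(q² + v B)/(q²-1)` and `ρ_φ := max (ρ_A, ρ_B)`:
for every nonzero `z ∈ L`, `v(β_n z^{q^n}) → ∞` (i.e. the series for `log_φ(z)`
converges) if and only if `v z > ρ_φ`. -/
theorem logCoeff_convergence_iff (p q s : ℕ) (hp : p.Prime) (hs : 1 ≤ s) (hq : q = p ^ s)
    (L : Type*) [Field L] [CharP L p]
    (v : L → EReal) (hv0 : ∀ x : L, v x = ⊤ ↔ x = 0) (hvb : ∀ x : L, v x ≠ ⊥)
    (hvm : ∀ x y : L, v (x * y) = v x + v y)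
    (hva : ∀ x y : L, min (v x) (v y) ≤ v (x + y))
    (T : L) (hvT : v T = -1) (A B : L) (hB : B ≠ 0)
    (β : ℕ → L) (hβ0 : β 0 = 1)
    (hβ1 : -(T ^ q ^ 1 - T) * β 1 = A * β 0)
    (hβ : ∀ n : ℕ,
      -(T ^ q ^ (n + 2) - T) * β (n + 2) = A ^ q ^ (n + 1) * β (n + 1) + B ^ q ^ n * β n)
    (z : L) (hz : z ≠ 0) :
    (∀ M : ℝ, ∃ N : ℕ, ∀ n : ℕ, N ≤ n → (M : EReal) < v (β n * z ^ q ^ n)) ↔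
      max (-(((q : ℝ) : EReal) + v A) * ((((q : ℝ) - 1)⁻¹ : ℝ) : EReal))
          (-((((q : ℝ) ^ 2 : ℝ) : EReal) + v B) * ((((q : ℝ) ^ 2 - 1)⁻¹ : ℝ) : EReal))
        < v z := by
  have hq2 : 2 ≤ q := hq ▸ hp.two_le.trans (Nat.le_self_pow (by omega) p)
  obtain ⟨f, hf, hfv⟩ := exists_absoluteValue_of_additive v hv0 hvb hvm hva
  have hv00 : v 0 = ⊤ := (hv0 0).2 rfl
  have hT0 : T ≠ 0 := by
    rintro rfl
    rw [hv00] at hvT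
    exact absurd hvT (by decide)
  have hfT : f T = Real.exp 1 := by
    have h := hfv T hT0
    rw [hvT, show (-1 : EReal) = ((-1 : ℝ) : EReal) by simp, EReal.coe_eq_coe_iff,
      neg_inj] at h
    rw [h, Real.exp_log (f.pos hT0)]
  have hlt : ∀ (M : ℝ) (x : L), (M : EReal) < v x ↔ f x < Real.exp (-M) := by
    intro M x
    by_cases hx : x = 0
    · simp [hx, hv00, Real.exp_pos, EReal.coe_lt_top]
    · rw [hfv x hx, EReal.coe_lt_coe_iff, lt_neg, Real.log_lt_iff_lt_exp (f.pos hx)]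
  have hB2 := neg_add_mul_inv_lt_iff hv00 hfv (hq2.trans (Nat.le_self_pow two_ne_zero q)) B hz
  rw [Nat.cast_pow] at hB2
  rw [max_lt_iff, neg_add_mul_inv_lt_iff hv00 hfv hq2 A hz, hB2, ← hfT,
    ← tendsto_abv_logCoeff_iff hf (by rw [hfT]; simp) hq2 hβ0 hβ1 hβ (f.pos hz)]
  simp only [hlt, map_mul, map_pow]
  rw [Metric.tendsto_atTop]
  have hdist : ∀ n, dist (f (β n) * f z ^ q ^ n) 0 = f (β n) * f z ^ q ^ n := fun n => by
    rw [Real.dist_0_eq_abs, abs_of_nonneg (by positivity)]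
  simp only [hdist]
  constructor
  · intro h ε hε
    simpa [Real.exp_log hε] using h (-Real.log ε)
  · exact fun h M => h _ (Real.exp_pos _)
end

section
/- Let q be a power of a prime p, let L be an algebraically closed field extension of 𝔽_q(T) with additive valuation v satisfying v(T) = −1, and let A, B ∈ L with B ≠ 0. If v(j) ≥ −q, where j := A^{q+1}/B, then every δ ∈ L with B δ^{q²−1} + A δ^{q−1} + T = 0 satisfies v(δ) = −(1 + v(B))/(q² − 1). -/
section FiniteValuation

variable {L : Type*} [Field L] {w : L → ℝ}

/-- A map that is additive on products of nonzero elements multiplies by `n` on `n`-th powers. -/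
lemma map_pow_of_map_mul (hwm : ∀ x y : L, x ≠ 0 → y ≠ 0 → w (x * y) = w x + w y)
    {x : L} (hx : x ≠ 0) (n : ℕ) : w (x ^ n) = n * w x := by
  induction n with
  | zero =>
    have h := hwm 1 1 one_ne_zero one_ne_zero
    rw [mul_one] at h
    simp only [pow_zero, Nat.cast_zero, zero_mul]
    linarith
  | succ n ih =>
    rw [pow_succ, hwm _ _ (pow_ne_zero n hx) hx, ih]
    push_cast
    ring

/-- A map that is additive on products of nonzero elements is even. -/
lemma map_neg_of_map_mul (hwm : ∀ x y : L, x ≠ 0 → y ≠ 0 → w (x * y) = w x + w y)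
    {x : L} (hx : x ≠ 0) : w (-x) = w x := by
  have h := map_pow_of_map_mul hwm (neg_ne_zero.mpr hx) 2
  rw [neg_sq, map_pow_of_map_mul hwm hx 2] at h
  push_cast at h
  linarith

/-- If three nonzero elements sum to zero, the value of each is at least the minimum of the
values of the other two. -/
lemma min_le_of_add_add_eq_zero
    (hwm : ∀ x y : L, x ≠ 0 → y ≠ 0 → w (x * y) = w x + w y)
    (hwa : ∀ x y : L, x ≠ 0 → y ≠ 0 → x + y ≠ 0 → min (w x) (w y) ≤ w (x + y))
    {x y z : L} (hx : x ≠ 0) (hy : y ≠ 0) (hz : z ≠ 0) (h : x + y + z = 0) :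
    min (w y) (w z) ≤ w x := by
  have hyz : y + z = -x := by linear_combination h
  have := hwa y z hy hz (hyz ▸ neg_ne_zero.mpr hx)
  rwa [hyz, map_neg_of_map_mul hwm hx] at this

/-- The finite-valued form of the theorem: the outer terms of the torsion equation have the
same value. -/
lemma map_add_mul_eq_of_torsion
    (hwm : ∀ x y : L, x ≠ 0 → y ≠ 0 → w (x * y) = w x + w y)
    (hwa : ∀ x y : L, x ≠ 0 → y ≠ 0 → x + y ≠ 0 → min (w x) (w y) ≤ w (x + y))
    {q : ℕ} (hq : 2 ≤ q) {T A B δ : L} (hT : T ≠ 0) (hwT : w T = -1) (hB : B ≠ 0) (hδ0 : δ ≠ 0)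
    (hj : A ≠ 0 → -(q : ℝ) ≤ w (A ^ (q + 1) / B))
    (hδ : B * δ ^ (q ^ 2 - 1) + A * δ ^ (q - 1) + T = 0) :
    w B + ((q : ℝ) ^ 2 - 1) * w δ = -1 := by
  have hq2 : 1 ≤ q ^ 2 := Nat.one_le_pow _ _ (by omega)
  have hX0 : B * δ ^ (q ^ 2 - 1) ≠ 0 := mul_ne_zero hB (pow_ne_zero _ hδ0)
  have hX : w (B * δ ^ (q ^ 2 - 1)) = w B + ((q : ℝ) ^ 2 - 1) * w δ := by
    rw [hwm _ _ hB (pow_ne_zero _ hδ0), map_pow_of_map_mul hwm hδ0, Nat.cast_sub hq2]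
    push_cast
    ring
  rw [← hX]
  rcases eq_or_ne A 0 with rfl | hA
  · have hXT : B * δ ^ (q ^ 2 - 1) = -T := by linear_combination hδ
    rw [hXT, map_neg_of_map_mul hwm hT, hwT]
  have hY0 : A * δ ^ (q - 1) ≠ 0 := mul_ne_zero hA (pow_ne_zero _ hδ0)
  have hY : w (A * δ ^ (q - 1)) = w A + ((q : ℝ) - 1) * w δ := by
    rw [hwm _ _ hA (pow_ne_zero _ hδ0), map_pow_of_map_mul hwm hδ0, Nat.cast_sub (by omega)]
    push_cast
    ring
  have hjB : w (A ^ (q + 1) / B) + w B = (q + 1) * w A := by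
    rw [← hwm _ _ (div_ne_zero (pow_ne_zero _ hA) hB) hB, div_mul_cancel₀ _ hB,
      map_pow_of_map_mul hwm hA]
    push_cast
    ring
  have hmid : w (B * δ ^ (q ^ 2 - 1)) - q ≤ (q + 1) * w (A * δ ^ (q - 1)) := by
    rw [hX, hY]
    linear_combination hj hA + hjB
  have h1 := min_le_of_add_add_eq_zero hwm hwa hX0 hY0 hT hδ
  have h2 := min_le_of_add_add_eq_zero hwm hwa hT hX0 hY0 (by linear_combination hδ)
  rw [hwT] at h1 h2
  have hq' : (2 : ℝ) ≤ q := by exact_mod_cast hq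
  generalize w (B * δ ^ (q ^ 2 - 1)) = X at *
  generalize w (A * δ ^ (q - 1)) = Y at *
  rcases lt_trichotomy X (-1) with h | h | h
  · have : Y ≤ X := by simpa [not_le.mpr h] using h1
    nlinarith
  · exact h
  · have : Y ≤ -1 := by simpa [not_le.mpr h] using h2
    nlinarith

end FiniteValuation

/-- Let `q = p^s` be a prime power, `L` an algebraically closed field extension of
`𝔽_q(T)` with additive valuation `v` (valued in `ℝ ∪ {∞} = ` `EReal`, `v x = ⊤ ↔ x = 0`)
satisfying `v T = -1`, and let `A, B ∈ L` with `B ≠ 0`.  If `v j ≥ -q`, where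
`j := A^{q+1}/B`, then every `δ` with `B δ^{q²-1} + A δ^{q-1} + T = 0` (i.e. every
nonzero `T`-torsion point of `φ_T = T + A τ + B τ²`) satisfies
`v δ = -(1 + v B)/(q² - 1)`. -/
theorem torsion_valuation_of_j_ge (p q s : ℕ) (hp : p.Prime) (hs : 1 ≤ s) (hq : q = p ^ s)
    (L : Type*) [Field L] [CharP L p] [IsAlgClosed L]
    (v : L → EReal) (hv0 : ∀ x : L, v x = ⊤ ↔ x = 0) (hvb : ∀ x : L, v x ≠ ⊥)
    (hvm : ∀ x y : L, v (x * y) = v x + v y)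
    (hva : ∀ x y : L, min (v x) (v y) ≤ v (x + y))
    (T : L) (hvT : v T = -1) (A B : L) (hB : B ≠ 0)
    (hj : ((-(q : ℝ) : ℝ) : EReal) ≤ v (A ^ (q + 1) / B))
    (δ : L) (hδ : B * δ ^ (q ^ 2 - 1) + A * δ ^ (q - 1) + T = 0) :
    v δ = -(1 + v B) * ((((q : ℝ) ^ 2 - 1)⁻¹ : ℝ) : EReal) := by
  have hq2 : 2 ≤ q := hq ▸ hp.two_le.trans (Nat.le_self_pow (by omega) p)
  have hfin : ∀ x : L, x ≠ 0 → ((v x).toReal : EReal) = v x := fun x hx =>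
    EReal.coe_toReal (mt (hv0 x).mp hx) (hvb x)
  have hT : T ≠ 0 := by
    rintro rfl
    rw [(hv0 0).mpr rfl] at hvT
    exact absurd hvT (by decide)
  have hδ0 : δ ≠ 0 := by
    rintro rfl
    have h1 : q ^ 2 - 1 ≠ 0 := by
      have : 2 ^ 2 ≤ q ^ 2 := Nat.pow_le_pow_left hq2 2
      omega
    have h2 : q - 1 ≠ 0 := by omega
    exact hT (by simpa [h1, h2] using hδ)
  have key := map_add_mul_eq_of_torsion (w := fun x => (v x).toReal)
    (fun x y hx hy => by
      simp only [hvm]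
      exact EReal.toReal_add (mt (hv0 x).mp hx) (hvb x) (mt (hv0 y).mp hy) (hvb y))
    (fun x y hx hy hxy => by
      have h := hva x y
      rw [← hfin x hx, ← hfin y hy, ← hfin _ hxy, min_le_iff] at h
      rw [min_le_iff]
      exact_mod_cast h)
    hq2 hT (by simp [hvT]) hB hδ0
    (fun hA => by
      rw [← hfin _ (div_ne_zero (pow_ne_zero _ hA) hB)] at hj
      exact_mod_cast hj) hδ
  have hq' : (2 : ℝ) ≤ q := by exact_mod_cast hq2
  have hne : (q : ℝ) ^ 2 - 1 ≠ 0 := by nlinarith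
  rw [← hfin δ hδ0, ← hfin B hB]
  have hval : (v δ).toReal = -(1 + (v B).toReal) * ((q : ℝ) ^ 2 - 1)⁻¹ := by
    field_simp
    linear_combination key
  rw [hval]
  push_cast
  rfl
end

section
/- Let q be a power of a prime p, let L be an algebraically closed field extension of 𝔽_q(T) with additive valuation v satisfying v(T) = −1, and let A, B ∈ L with B ≠ 0. Suppose v(j) < −q, where j := A^{q+1}/B. Then −(1 + v(A))/(q − 1) > (v(A) − v(B))/(q² − q), there exists η ∈ L with B η^{q²−1} + A η^{q−1} + T = 0 and v(η) = −(1 + v(A))/(q − 1), and every δ ∈ L with B δ^{q²−1} + A δ^{q−1} + T = 0 that does not lie in 𝔽_q·η satisfies v(δ) = (v(A) − v(B))/(q² − q). In particular the set of such roots of valuation −(1 + v(A))/(q − 1) is exactly 𝔽_q^*·η. -/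
open Polynomial

/-- `w` is the restriction to `L \ {0}` of an additive valuation; its value at `0` is irrelevant. -/
structure IsRealValuation {L : Type*} [Field L] (w : L → ℝ) : Prop where
  mul : ∀ x y : L, x ≠ 0 → y ≠ 0 → w (x * y) = w x + w y
  add : ∀ x y : L, x ≠ 0 → y ≠ 0 → x + y ≠ 0 → min (w x) (w y) ≤ w (x + y)

namespace IsRealValuation

variable {L : Type*} [Field L] {w : L → ℝ}

theorem one (h : IsRealValuation w) : w 1 = 0 := by
  have := h.mul 1 1 one_ne_zero one_ne_zero
  rw [mul_one] at this
  linarith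

theorem pow (h : IsRealValuation w) {x : L} (hx : x ≠ 0) (n : ℕ) : w (x ^ n) = n * w x := by
  induction n with
  | zero => simp [h.one]
  | succ n ih =>
    rw [pow_succ, h.mul _ _ (pow_ne_zero n hx) hx, ih]
    push_cast
    ring

theorem neg_one (h : IsRealValuation w) : w (-1) = 0 := by
  have := h.pow (x := (-1 : L)) (by simp) 2
  rw [neg_one_sq, h.one] at this
  push_cast at this
  linarith

theorem neg (h : IsRealValuation w) {x : L} (hx : x ≠ 0) : w (-x) = w x := by
  rw [← neg_one_mul, h.mul _ _ (by simp) hx, h.neg_one, zero_add]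

theorem min_le_of_add_add_eq_zero (h : IsRealValuation w) {x y z : L} (hx : x ≠ 0) (hy : y ≠ 0)
    (hz : z ≠ 0) (hxyz : x + y + z = 0) : min (w x) (w y) ≤ w z := by
  have hxy : x + y = -z := eq_neg_of_add_eq_zero_left hxyz
  have := h.add x y hx hy (by rw [hxy]; exact neg_ne_zero.mpr hz)
  rwa [hxy, h.neg hz] at this

theorem eq_zero_or_le_sum (h : IsRealValuation w) {ι : Type*} (s : Finset ι) (f : ι → L) (c : ℝ)
    (hf : ∀ i ∈ s, f i ≠ 0 ∧ c ≤ w (f i)) : ∑ i ∈ s, f i = 0 ∨ c ≤ w (∑ i ∈ s, f i) := by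
  classical
  induction s using Finset.induction_on with
  | empty => simp
  | insert a s ha ih =>
    rw [Finset.sum_insert ha]
    obtain ⟨hfa, hca⟩ := hf a (Finset.mem_insert_self a s)
    rcases eq_or_ne (f a + ∑ i ∈ s, f i) 0 with h0 | h0
    · exact Or.inl h0
    right
    rcases eq_or_ne (∑ i ∈ s, f i) 0 with hs0 | hs0
    · rwa [hs0, add_zero]
    have hcs := (ih fun i hi => hf i (Finset.mem_insert_of_mem hi)).resolve_left hs0
    exact (le_min hca hcs).trans (h.add _ _ hfa hs0 h0)

theorem multiset_prod (h : IsRealValuation w) (s : Multiset L) (c : ℝ)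
    (hs : ∀ y ∈ s, y ≠ 0 ∧ w y = c) : s.prod ≠ 0 ∧ w s.prod = s.card * c := by
  induction s using Multiset.induction_on with
  | empty => simp [h.one]
  | cons a s ih =>
    obtain ⟨h0, hc⟩ := ih fun y hy => hs y (Multiset.mem_cons_of_mem hy)
    obtain ⟨ha, hac⟩ := hs a (Multiset.mem_cons_self a s)
    rw [Multiset.prod_cons, Multiset.card_cons]
    refine ⟨mul_ne_zero ha h0, ?_⟩
    rw [h.mul _ _ ha h0, hc, hac]
    push_cast
    ring

variable {A B T : L} {q : ℕ}

/-- The two slopes of the Newton polygon of `B y ^ (q + 1) + A y + T` when its vertex at `1` lies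
below the segment joining the outer ones. -/
theorem root_eq_or_eq (h : IsRealValuation w) (hA : A ≠ 0) (hB : B ≠ 0) (hT : T ≠ 0)
    (hq : 0 < q) (hj : (q + 1) * w A < w B + q * w T) {y : L}
    (hy : B * y ^ (q + 1) + A * y + T = 0) : w y = w T - w A ∨ q * w y = w A - w B := by
  have hy0 : y ≠ 0 := by
    rintro rfl
    simp [hT] at hy
  have hyq := pow_ne_zero (q + 1) hy0
  have h1 := mul_ne_zero hB hyq
  have h2 := mul_ne_zero hA hy0
  have m1 := h.min_le_of_add_add_eq_zero h1 h2 hT hy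
  have m2 := h.min_le_of_add_add_eq_zero h1 hT h2 (by linear_combination hy)
  have m3 := h.min_le_of_add_add_eq_zero h2 hT h1 (by linear_combination hy)
  rw [h.mul _ _ hB hyq, h.pow hy0, h.mul _ _ hA hy0] at m1 m2 m3
  push_cast at m1 m2 m3
  have hq' : (0 : ℝ) < q := by exact_mod_cast hq
  simp only [min_le_iff] at m1 m2 m3
  by_cases e1 : w A + w y = w T
  · left; linarith
  right
  by_cases e2 : w B + (q + 1) * w y = w A + w y
  · linarith
  exfalso
  have e3 : w B + (q + 1) * w y = w T ∧ w T < w A + w y := by grind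
  nlinarith [e3.1, e3.2]

theorem exists_root (h : IsRealValuation w) [IsAlgClosed L] (hA : A ≠ 0) (hB : B ≠ 0)
    (hT : T ≠ 0) (hq : 0 < q) (hj : (q + 1) * w A < w B + q * w T) :
    ∃ y : L, B * y ^ (q + 1) + A * y + T = 0 ∧ w y = w T - w A := by
  by_contra! hne
  set P : L[X] := C B * X ^ (q + 1) + C A * X + C T with hP
  have hdeg : P.natDegree = q + 1 := by
    rw [hP]
    compute_degree!
    simp [hq.ne', hB]
  have hlead : P.leadingCoeff = B := by
    rw [leadingCoeff, hdeg]
    simp [hP, coeff_C, hq.ne']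
  have hP0 : P ≠ 0 := by
    rintro h0
    rw [h0, leadingCoeff_zero] at hlead
    exact hB hlead.symm
  have hsplit := IsAlgClosed.splits P
  have hroots : ∀ y ∈ P.roots, y ≠ 0 ∧ w y = (w A - w B) / q := by
    intro y hy
    have hy' : B * y ^ (q + 1) + A * y + T = 0 := by
      have := (mem_roots hP0).mp hy
      simpa [hP, IsRoot] using this
    refine ⟨?_, ?_⟩
    · rintro rfl
      simp [hT] at hy'
    · have := (h.root_eq_or_eq hA hB hT hq hj hy').resolve_left (hne y hy')
      rw [eq_div_iff (by positivity)]
      linarith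
  obtain ⟨hp0, hpw⟩ := h.multiset_prod _ _ hroots
  have hcoeff := hsplit.coeff_zero_eq_leadingCoeff_mul_prod_roots
  have hc0 : P.coeff 0 = T := by simp [hP]
  have hsign : ((-1 : L) ^ (q + 1)) ≠ 0 := pow_ne_zero _ (by simp)
  rw [hc0, hdeg, hlead] at hcoeff
  have hcard : P.roots.card = q + 1 := by rw [← hsplit.natDegree_eq_card_roots, hdeg]
  have hw := congrArg w hcoeff
  rw [h.mul _ _ (mul_ne_zero hsign hB) hp0, h.mul _ _ hsign hB, h.pow (by simp), h.neg_one, hpw,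
    hcard] at hw
  have hq' : (0 : ℝ) < q := by exact_mod_cast hq
  push_cast at hw
  field_simp at hw
  nlinarith

theorem root_unique (h : IsRealValuation w) (hA : A ≠ 0) (hB : B ≠ 0)
    (hj : (q + 1) * w A < w B + q * w T) {y z : L} (hy0 : y ≠ 0) (hz0 : z ≠ 0)
    (hy : B * y ^ (q + 1) + A * y + T = 0) (hz : B * z ^ (q + 1) + A * z + T = 0)
    (hwy : w y = w T - w A) (hwz : w z = w T - w A) : y = z := by
  by_contra hne
  have hgeom := (Commute.all y z).geom_sum₂_mul (q + 1)
  set S := ∑ i ∈ Finset.range (q + 1), y ^ i * z ^ (q + 1 - 1 - i) with hS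
  have hBS : B * S = -A := by
    apply mul_right_cancel₀ (sub_ne_zero.mpr hne)
    linear_combination B * hgeom + hy - hz
  have hS0 : S ≠ 0 := by
    intro h0
    rw [h0, mul_zero] at hBS
    exact hA (neg_eq_zero.mp hBS.symm)
  have hle : q * (w T - w A) ≤ w S := by
    refine (h.eq_zero_or_le_sum _ _ _ fun i hi => ?_).resolve_left hS0
    have hyi := pow_ne_zero i hy0
    have hzi := pow_ne_zero (q + 1 - 1 - i) hz0
    refine ⟨mul_ne_zero hyi hzi, ?_⟩
    have hiq : i ≤ q := Nat.lt_succ_iff.mp (Finset.mem_range.mp hi)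
    rw [h.mul _ _ hyi hzi, h.pow hy0, h.pow hz0, hwy, hwz, Nat.add_sub_cancel, Nat.cast_sub hiq]
    apply le_of_eq
    ring
  have hw := congrArg w hBS
  rw [h.mul _ _ hB hS0, h.neg hA] at hw
  nlinarith

end IsRealValuation

/-- An `EReal`-valued additive valuation is real-valued away from `0`. -/
theorem isRealValuation_toReal {L : Type*} [Field L] {v : L → EReal}
    (hv0 : ∀ x : L, v x = ⊤ ↔ x = 0) (hvb : ∀ x : L, v x ≠ ⊥)
    (hvm : ∀ x y : L, v (x * y) = v x + v y)
    (hva : ∀ x y : L, min (v x) (v y) ≤ v (x + y)) :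
    IsRealValuation fun x => (v x).toReal where
  mul x y hx hy := by
    simp only [hvm]
    exact EReal.toReal_add (mt (hv0 x).mp hx) (hvb x) (mt (hv0 y).mp hy) (hvb y)
  add x y hx hy hxy := by
    have hc : ∀ z : L, z ≠ 0 → v z = ((v z).toReal : EReal) := fun z hz =>
      (EReal.coe_toReal (mt (hv0 z).mp hz) (hvb z)).symm
    have := hva x y
    rw [hc x hx, hc y hy, hc _ hxy] at this
    rwa [← EReal.coe_strictMono.monotone.map_min, EReal.coe_le_coe_iff] at this

/-- Let `q = p^s` be a prime power, `L` an algebraically closed field extension of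
`𝔽_q(T)` with additive valuation `v` (valued in `ℝ ∪ {∞} = ` `EReal`, `v x = ⊤ ↔ x = 0`)
satisfying `v T = -1`, and let `A, B ∈ L` with `B ≠ 0` and `v j < -q` where
`j := A^{q+1}/B`.  Then `-(1 + v A)/(q-1) > (v A - v B)/(q²-q)`; there is an `η` with
`B η^{q²-1} + A η^{q-1} + T = 0` and `v η = -(1 + v A)/(q-1)`; every root `δ` of
`B x^{q²-1} + A x^{q-1} + T` not lying in `𝔽_q·η` (the `𝔽_q`-elements of `L` being those
`a` with `a^q = a`) satisfies `v δ = (v A - v B)/(q²-q)`; and the set of such roots of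
valuation `-(1 + v A)/(q-1)` is exactly `𝔽_q^*·η`. -/
theorem torsion_valuation_of_j_lt (p q s : ℕ) (hp : p.Prime) (hs : 1 ≤ s) (hq : q = p ^ s)
    (L : Type*) [Field L] [CharP L p] [IsAlgClosed L]
    (v : L → EReal) (hv0 : ∀ x : L, v x = ⊤ ↔ x = 0) (hvb : ∀ x : L, v x ≠ ⊥)
    (hvm : ∀ x y : L, v (x * y) = v x + v y)
    (hva : ∀ x y : L, min (v x) (v y) ≤ v (x + y))
    (T : L) (hvT : v T = -1) (A B : L) (hB : B ≠ 0)
    (hj : v (A ^ (q + 1) / B) < ((-(q : ℝ) : ℝ) : EReal)) :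
    ((v A - v B) * ((((q : ℝ) ^ 2 - (q : ℝ))⁻¹ : ℝ) : EReal) <
        -(1 + v A) * ((((q : ℝ) - 1)⁻¹ : ℝ) : EReal)) ∧
    ∃ η : L,
      (B * η ^ (q ^ 2 - 1) + A * η ^ (q - 1) + T = 0 ∧
        v η = -(1 + v A) * ((((q : ℝ) - 1)⁻¹ : ℝ) : EReal)) ∧
      (∀ δ : L, B * δ ^ (q ^ 2 - 1) + A * δ ^ (q - 1) + T = 0 →
        (¬ ∃ a : L, a ^ q = a ∧ δ = a * η) →
        v δ = (v A - v B) * ((((q : ℝ) ^ 2 - (q : ℝ))⁻¹ : ℝ) : EReal)) ∧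
      (∀ x : L,
        (B * x ^ (q ^ 2 - 1) + A * x ^ (q - 1) + T = 0 ∧
            v x = -(1 + v A) * ((((q : ℝ) - 1)⁻¹ : ℝ) : EReal)) ↔
          ∃ a : L, a ^ q = a ∧ a ≠ 0 ∧ x = a * η) := by
  have hq2 : 2 ≤ q := by
    rw [hq]
    exact hp.two_le.trans (Nat.le_self_pow (by omega) p)
  have h := isRealValuation_toReal hv0 hvb hvm hva
  set w : L → ℝ := fun x => (v x).toReal with hw
  have hc : ∀ z : L, z ≠ 0 → v z = (w z : EReal) := fun z hz =>
    (EReal.coe_toReal (mt (hv0 z).mp hz) (hvb z)).symm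
  have hT : T ≠ 0 := by
    rintro rfl
    rw [(hv0 0).mpr rfl] at hvT
    exact EReal.coe_ne_top (-1) (by rw [EReal.coe_neg, EReal.coe_one, hvT])
  have hA : A ≠ 0 := by
    rintro rfl
    rw [zero_pow (by omega), zero_div, (hv0 0).mpr rfl] at hj
    exact not_top_lt hj
  have hwT : w T = -1 := by
    simp [hw, hvT]
  have hjr : (q + 1) * w A < w B + q * w T := by
    have hj0 : A ^ (q + 1) / B ≠ 0 := div_ne_zero (pow_ne_zero _ hA) hB
    rw [hc _ hj0, EReal.coe_lt_coe_iff] at hj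
    have hmul := h.mul _ _ hj0 hB
    rw [div_mul_cancel₀ _ hB, h.pow hA] at hmul
    push_cast at hmul
    rw [hwT]
    linarith
  have hqr : (2 : ℝ) ≤ q := by exact_mod_cast hq2
  have hq1 : (0 : ℝ) < q - 1 := by linarith
  have hqq : (q : ℝ) ^ 2 - q = q * (q - 1) := by ring
  have hsmall : (v A - v B) * ((((q : ℝ) ^ 2 - (q : ℝ))⁻¹ : ℝ) : EReal) =
      (((w A - w B) / (q * (q - 1)) : ℝ) : EReal) := by
    rw [hc A hA, hc B hB, hqq, div_eq_mul_inv]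
    norm_cast
  have hlarge : -(1 + v A) * ((((q : ℝ) - 1)⁻¹ : ℝ) : EReal) =
      (((w T - w A) / (q - 1) : ℝ) : EReal) := by
    rw [hc A hA, hwT, div_eq_mul_inv, show -1 - w A = -(1 + w A) by ring]
    norm_cast
  rw [hsmall, hlarge]
  have hpow : ∀ x : L, x ^ (q ^ 2 - 1) = (x ^ (q - 1)) ^ (q + 1) := by
    intro x
    rw [← pow_mul, mul_comm, ← Nat.sq_sub_sq, one_pow]
  simp only [hpow]
  have hwpow : ∀ x : L, x ≠ 0 → w (x ^ (q - 1)) = (q - 1) * w x := by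
    intro x hx
    rw [h.pow hx, Nat.cast_sub (by omega), Nat.cast_one]
  have hne : ∀ x : L, B * (x ^ (q - 1)) ^ (q + 1) + A * x ^ (q - 1) + T = 0 → x ≠ 0 := by
    rintro x hx rfl
    rw [zero_pow (show q - 1 ≠ 0 by omega)] at hx
    simp [hT] at hx
  have hval : ∀ x : L, x ≠ 0 →
      (v x = (((w T - w A) / (q - 1) : ℝ) : EReal) ↔ w (x ^ (q - 1)) = w T - w A) := by
    intro x hx
    rw [hc x hx, EReal.coe_eq_coe_iff, hwpow x hx, eq_div_iff hq1.ne', mul_comm]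
  obtain ⟨y, hy, hwy⟩ := h.exists_root hA hB hT (by omega) hjr
  obtain ⟨η, rfl⟩ := IsAlgClosed.exists_pow_nat_eq y (show 0 < q - 1 by omega)
  have hη := hne η hy
  have hline : ∀ x : L, (B * (x ^ (q - 1)) ^ (q + 1) + A * x ^ (q - 1) + T = 0 ∧
      v x = (((w T - w A) / (q - 1) : ℝ) : EReal)) ↔ ∃ a : L, a ^ q = a ∧ a ≠ 0 ∧ x = a * η := by
    intro x
    constructor
    · rintro ⟨hx, hvx⟩
      have hx0 := hne x hx
      have heq := h.root_unique hA hB hjr (pow_ne_zero _ hx0) (pow_ne_zero _ hη) hx hy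
        ((hval x hx0).mp hvx) hwy
      have ha : (x / η) ^ (q - 1) = 1 := by
        rw [div_pow, heq, div_self (pow_ne_zero _ hη)]
      refine ⟨x / η, ?_, div_ne_zero hx0 hη, (div_mul_cancel₀ x hη).symm⟩
      rw [← Nat.sub_add_cancel (show 1 ≤ q by omega), pow_succ, ha, one_mul]
    · rintro ⟨a, ha, ha0, rfl⟩
      have ha1 : a ^ (q - 1) = 1 := by
        apply mul_right_cancel₀ ha0
        rw [← pow_succ, Nat.sub_add_cancel (show 1 ≤ q by omega), ha, one_mul]
      have heq : (a * η) ^ (q - 1) = η ^ (q - 1) := by rw [mul_pow, ha1, one_mul]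
      rw [hval _ (mul_ne_zero ha0 hη), heq]
      exact ⟨hy, hwy⟩
  refine ⟨?_, η, ⟨hy, (hval η hη).mpr hwy⟩, ?_, hline⟩
  · rw [EReal.coe_lt_coe_iff, div_lt_div_iff₀ (by positivity) hq1]
    nlinarith
  · intro δ hδ hδη
    have hδ0 := hne δ hδ
    rcases h.root_eq_or_eq hA hB hT (by omega) hjr hδ with hl | hs'
    · obtain ⟨a, ha, -, hx⟩ := (hline δ).mp ⟨hδ, (hval δ hδ0).mpr hl⟩
      exact absurd ⟨a, ha, hx⟩ hδη
    · rw [hc δ hδ0, EReal.coe_eq_coe_iff, eq_div_iff (by positivity), ← hs', hwpow δ hδ0]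
      ring
end

section
/- Let q = p^s be a power of a prime p and let L be a field of characteristic p containing 𝔽_q. Let T, A, B, δ ∈ L with δ ≠ 0 and B δ^{q²} + A δ^{q} + T δ = 0. Then for every x ∈ L, B x^{q²} + A x^{q} + T x = B (x^q − δ^{q−1} x)^q − T δ^{1−q} (x^q − δ^{q−1} x). Consequently, if c ∈ L satisfies B c^{q−1} = T and ζ ∈ L satisfies ζ^q − δ^{q−1} ζ = δ^{−1} c, then B ζ^{q²} + A ζ^{q} + T ζ = 0. -/
/-- Let `q = p^s` be a prime power and `L` a field of characteristic `p` containing `𝔽_q`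
(encoded: `L` has `q` distinct elements `a` with `a^q = a`).  Let `T, A, B, δ ∈ L` with
`δ ≠ 0` and `B δ^{q²} + A δ^q + T δ = 0`.  Then for every `x ∈ L`,
`B x^{q²} + A x^q + T x = B (x^q - δ^{q-1} x)^q - T δ^{1-q} (x^q - δ^{q-1} x)`.
Consequently, if `B c^{q-1} = T` and `ζ^q - δ^{q-1} ζ = δ⁻¹ c`, then
`B ζ^{q²} + A ζ^q + T ζ = 0`. -/
theorem torsion_polynomial_factorization (p q s : ℕ) (hp : p.Prime) (hs : 1 ≤ s)
    (hq : q = p ^ s) (L : Type*) [Field L] [CharP L p]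
    (hFq : ∃ Φ : Finset L, Φ.card = q ∧ ∀ a ∈ Φ, a ^ q = a)
    (T A B δ : L) (hδ0 : δ ≠ 0) (hδ : B * δ ^ q ^ 2 + A * δ ^ q + T * δ = 0) :
    (∀ x : L,
      B * x ^ q ^ 2 + A * x ^ q + T * x =
        B * (x ^ q - δ ^ (q - 1) * x) ^ q -
          T * δ ^ ((1 : ℤ) - (q : ℤ)) * (x ^ q - δ ^ (q - 1) * x)) ∧
    (∀ c ζ : L, B * c ^ (q - 1) = T → ζ ^ q - δ ^ (q - 1) * ζ = δ⁻¹ * c →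
      B * ζ ^ q ^ 2 + A * ζ ^ q + T * ζ = 0) := by
  have := Fact.mk hp
  have hq_pos : 1 ≤ q := hq ▸ Nat.one_le_pow _ _ hp.pos
  have sub_pow_q (x y : L) : (x - y) ^ q = x ^ q - y ^ q := by
    rw [hq]; exact sub_pow_char_pow x y s
  have pow_q (x : L) : x ^ q = x ^ (q - 1) * x := by
    rw [← pow_succ, Nat.sub_add_cancel hq_pos]
  have hzpow : δ ^ ((1 : ℤ) - (q : ℤ)) = (δ ^ (q - 1))⁻¹ := by
    rw [← zpow_natCast, ← zpow_neg, Nat.cast_sub hq_pos, Nat.cast_one, neg_sub]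
  have hu : δ ^ (q - 1) ≠ 0 := pow_ne_zero _ hδ0
  have hA : A = -(B * (δ ^ (q - 1)) ^ q) - T * (δ ^ (q - 1))⁻¹ := by
    rw [sq, pow_mul, pow_q δ, mul_pow, pow_q δ] at hδ
    have hcancel : B * (δ ^ (q - 1)) ^ q * δ ^ (q - 1) + A * δ ^ (q - 1) + T = 0 :=
      mul_right_cancel₀ hδ0 (by linear_combination hδ)
    field_simp
    linear_combination hcancel
  have factorization (x : L) : B * x ^ q ^ 2 + A * x ^ q + T * x =
      B * (x ^ q - δ ^ (q - 1) * x) ^ q -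
        T * δ ^ ((1 : ℤ) - (q : ℤ)) * (x ^ q - δ ^ (q - 1) * x) := by
    rw [hzpow, sub_pow_q, mul_pow, sq, pow_mul, hA]
    linear_combination -(T * x) * inv_mul_cancel₀ hu
  refine ⟨factorization, fun c ζ hc hζ => ?_⟩
  rw [factorization, hζ, hzpow, mul_pow, pow_q c, inv_pow, pow_q δ, mul_inv, ← hc]
  ring
end
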